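/- Every anti-endomorphism f of A₁ that commutes with the exchange involution α (i.e., f ∘ α = α ∘ f) is an anti-automorphism of A₁ (in particular, f is bijective). Moreover, there exist n ∈ ℕ and scalars a, b, c₀, …, c_n ∈ K with a² − b² = −1 such that f(X) = aX + bY + Σ_{j=0}^{n} c_j (X − Y)^{2j} and f(Y) = aY + bX + Σ_{j=0}^{n} c_j (X − Y)^{2j}. -/

import Mathlib

noncomputable section

/-- `f : A → A` is a `K`-algebra endomorphism (as a bare function). -/
def IsAlgEndo (K : Type) [CommSemiring K] {A : Type} [Semiring A] [Algebra K A]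
    (f : A → A) : Prop :=
  (∀ a b : A, f (a + b) = f a + f b) ∧
  (∀ (c : K) (a : A), f (c • a) = c • f a) ∧
  (∀ a b : A, f (a * b) = f a * f b) ∧ f 1 = 1

/-- `f : A → A` is a `K`-algebra automorphism: a bijective endomorphism. -/
def IsAlgAuto (K : Type) [CommSemiring K] {A : Type} [Semiring A] [Algebra K A]
    (f : A → A) : Prop :=
  IsAlgEndo K f ∧ Function.Bijective f

/-- `f : A → A` is a `K`-linear anti-endomorphism. -/
def IsAntiEndo (K : Type) [CommSemiring K] {A : Type} [Semiring A] [Algebra K A]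
    (f : A → A) : Prop :=
  (∀ a b : A, f (a + b) = f a + f b) ∧
  (∀ (c : K) (a : A), f (c • a) = c • f a) ∧
  (∀ a b : A, f (a * b) = f b * f a) ∧ f 1 = 1

/-- `f : A → A` is an anti-automorphism: a bijective anti-endomorphism. -/
def IsAntiAuto (K : Type) [CommSemiring K] {A : Type} [Semiring A] [Algebra K A]
    (f : A → A) : Prop :=
  IsAntiEndo K f ∧ Function.Bijective f

/-- An involution on a `K`-algebra: an anti-automorphism of order at most two. -/
def IsInvolutionOn (K : Type) [CommSemiring K] {A : Type} [Semiring A] [Algebra K A]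
    (γ : A → A) : Prop :=
  IsAntiAuto K γ ∧ γ ∘ γ = id

/-- The defining relation of the first Weyl algebra: `Y*X = X*Y + 1`. -/
inductive WeylRel (K : Type) [CommSemiring K] :
    FreeAlgebra K (Fin 2) → FreeAlgebra K (Fin 2) → Prop
  | rel : WeylRel K (FreeAlgebra.ι K 1 * FreeAlgebra.ι K 0)
      (FreeAlgebra.ι K 0 * FreeAlgebra.ι K 1 + 1)

/-- The first Weyl algebra `A₁(K) = K⟨X,Y⟩/(YX - XY - 1)`. -/
abbrev Weyl (K : Type) [CommSemiring K] : Type := RingQuot (WeylRel K)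

/-- The generator `X` of the Weyl algebra. -/
def Wx (K : Type) [CommSemiring K] : Weyl K :=
  RingQuot.mkAlgHom K (WeylRel K) (FreeAlgebra.ι K 0)

/-- The generator `Y` of the Weyl algebra. -/
def Wy (K : Type) [CommSemiring K] : Weyl K :=
  RingQuot.mkAlgHom K (WeylRel K) (FreeAlgebra.ι K 1)

/-- `α` is the exchange involution: the involution with `α X = Y` and `α Y = X`. -/
def IsExchange (K : Type) [CommSemiring K] (α : Weyl K → Weyl K) : Prop :=
  IsInvolutionOn K α ∧ α (Wx K) = Wy K ∧ α (Wy K) = Wx K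

/-- `γ` is conjugate to `α` by an automorphism or an anti-automorphism:
`γ = g⁻¹ ∘ α ∘ g`. -/
def ConjToAlpha (K : Type) [CommSemiring K] (α γ : Weyl K → Weyl K) : Prop :=
  ∃ g : Weyl K → Weyl K, (IsAlgAuto K g ∨ IsAntiAuto K g) ∧
    γ = Function.invFun g ∘ α ∘ g

noncomputable section
open Polynomial

section WeylBasics

def WW (R : Type) [CommRing R] : Type := Weyl R

instance instRingWW (R : Type) [CommRing R] : Ring (WW R) :=
  inferInstanceAs (Ring (RingQuot (WeylRel R)))

instance instAlgWW (R : Type) [CommRing R] : Algebra R (WW R) :=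
  inferInstanceAs (Algebra R (RingQuot (WeylRel R)))

variable (R : Type) [CommRing R]

def wx : WW R := Wx R
def wy : WW R := Wy R

theorem Wyx0 : Wy R * Wx R = Wx R * Wy R + 1 := by
  have := RingQuot.mkAlgHom_rel R (WeylRel.rel (K := R))
  simpa [Wx, Wy] using this

theorem Wyx : wy R * wx R = wx R * wy R + 1 := Wyx0 R

def weylLift0 {A : Type} [Semiring A] [Algebra R A] (x y : A) (h : y * x = x * y + 1) :
    Weyl R →ₐ[R] A :=
  RingQuot.liftAlgHom R ⟨FreeAlgebra.lift R ![x, y], by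
    rintro _ _ ⟨⟩; simp [h]⟩

def weylLift {A : Type} [Semiring A] [Algebra R A] (x y : A) (h : y * x = x * y + 1) :
    WW R →ₐ[R] A := weylLift0 R x y h

@[simp] theorem weylLift_x {A : Type} [Semiring A] [Algebra R A] (x y : A)
    (h : y * x = x * y + 1) : weylLift R x y h (wx R) = x := by
  have : weylLift0 R x y h (Wx R) = x := by simp [weylLift0, Wx]
  exact this

@[simp] theorem weylLift_y {A : Type} [Semiring A] [Algebra R A] (x y : A)
    (h : y * x = x * y + 1) : weylLift R x y h (wy R) = y := by
  have : weylLift0 R x y h (Wy R) = y := by simp [weylLift0, Wy]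
  exact this

variable {R}
theorem weyl_hom_ext0 {A : Type} [Semiring A] [Algebra R A] {f g : Weyl R →ₐ[R] A}
    (hx : f (Wx R) = g (Wx R)) (hy : f (Wy R) = g (Wy R)) : f = g := by
  apply RingQuot.ringQuot_ext'
  apply FreeAlgebra.hom_ext
  funext i
  fin_cases i
  · exact hx
  · exact hy

theorem weyl_hom_ext {A : Type} [Semiring A] [Algebra R A] {f g : WW R →ₐ[R] A}
    (hx : f (wx R) = g (wx R)) (hy : f (wy R) = g (wy R)) : f = g :=
  weyl_hom_ext0 (R := R) (A := A) (f := f) (g := g) hx hy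

theorem weyl_adjoin : Algebra.adjoin R {wx R, wy R} = ⊤ := by
  set S := Algebra.adjoin R {wx R, wy R} with hS
  have hx : wx R ∈ S := Algebra.subset_adjoin (by simp)
  have hy : wy R ∈ S := Algebra.subset_adjoin (by simp)
  let f : WW R →ₐ[R] S := weylLift R ⟨wx R, hx⟩ ⟨wy R, hy⟩ (by
    ext; simpa using Wyx R)
  have h : S.val.comp f = AlgHom.id R _ := by
    apply weyl_hom_ext <;> simp [f]
  rw [eq_top_iff]
  intro w _
  have := congrArg (fun g => g w) h
  simp only [AlgHom.comp_apply, AlgHom.id_apply] at this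
  rw [← this]
  exact (f w).2

theorem weyl_induction {p : WW R → Prop} (hc : ∀ r, p (algebraMap R _ r))
    (hx : p (wx R)) (hy : p (wy R)) (ha : ∀ a b, p a → p b → p (a + b))
    (hm : ∀ a b, p a → p b → p (a * b)) (w : WW R) : p w := by
  have h : w ∈ Algebra.adjoin R {wx R, wy R} := by rw [weyl_adjoin]; trivial
  induction h using Algebra.adjoin_induction with
  | mem x hx' =>
    rcases hx' with rfl | rfl
    · exact hx
    · exact hy
  | algebraMap r => exact hc r
  | add x y _ _ h1 h2 => exact ha _ _ h1 h2
  | mul x y _ _ h1 h2 => exact hm _ _ h1 h2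

variable (R)
def opX : Module.End R R[X][X] := LinearMap.mulLeft R (X : R[X][X])
def opY : Module.End R R[X][X] :=
  LinearMap.mulLeft R (C X : R[X][X]) + (derivative (R := R[X])).restrictScalars R

variable {R}
theorem opX_apply (g : R[X][X]) : opX R g = X * g := rfl
theorem opY_apply (g : R[X][X]) : opY R g = C X * g + derivative g := rfl

variable (R)
def rep : WW R →ₐ[R] Module.End R R[X][X] := weylLift R (opX R) (opY R) (by
  ext1 g
  simp [opX_apply, opY_apply, Module.End.mul_apply]
  ring)

variable {R}
@[simp] theorem rep_x : rep R (wx R) = opX R := by simp [rep]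
@[simp] theorem rep_y : rep R (wy R) = opY R := by simp [rep]

variable (R) in
def sym : WW R →ₗ[R] R[X][X] where
  toFun w := rep R w 1
  map_add' a b := by simp
  map_smul' a b := by simp

theorem sym_apply (w : WW R) : sym R w = rep R w 1 := rfl

theorem sym_mul (v w : WW R) : sym R (v * w) = rep R v (sym R w) := by
  simp [sym_apply, Module.End.mul_apply]

def tau (g : R[X][X]) : WW R := g.sum fun i a => wx R ^ i * aeval (wy R) a

theorem tau_add (f g : R[X][X]) : tau (f + g) = tau f + tau g := by
  unfold tau
  rw [Polynomial.sum_add_index]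
  · simp
  · intro i a b; simp [mul_add]

theorem tau_monomial (i : ℕ) (a : R[X]) : tau (monomial i a) = wx R ^ i * aeval (wy R) a := by
  unfold tau
  rw [Polynomial.sum_monomial_index]; simp

theorem tau_smul (r : R) (g : R[X][X]) : tau (r • g) = r • tau g := by
  induction g using Polynomial.induction_on' with
  | add f g hf hg => rw [smul_add, tau_add, tau_add, hf, hg, smul_add]
  | monomial i a => rw [smul_monomial, tau_monomial, tau_monomial]; simp

theorem y_mul_xpow (i : ℕ) : wy R * wx R ^ i = wx R ^ i * wy R + i * wx R ^ (i - 1) := by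
  induction i with
  | zero => simp
  | succ n ih =>
    rw [pow_succ, ← mul_assoc, ih, add_mul, mul_assoc, Wyx, mul_add, ← mul_assoc, mul_one]
    rcases n with _ | n
    · simp
    · simp [pow_succ, mul_assoc, add_mul]; abel

theorem tau_opX (g : R[X][X]) : tau (opX R g) = wx R * tau g := by
  induction g using Polynomial.induction_on' with
  | add f g hf hg => rw [map_add, tau_add, tau_add, hf, hg, mul_add]
  | monomial i a =>
    rw [opX_apply, X_mul_monomial, tau_monomial, tau_monomial, pow_succ', mul_assoc]

theorem tau_opY (g : R[X][X]) : tau (opY R g) = wy R * tau g := by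
  induction g using Polynomial.induction_on' with
  | add f g hf hg => rw [map_add, tau_add, tau_add, hf, hg, mul_add]
  | monomial i a =>
    rw [opY_apply, C_mul_monomial, derivative_monomial, tau_add, tau_monomial, tau_monomial,
      tau_monomial, ← mul_assoc, y_mul_xpow, add_mul]
    congr 1
    · simp [mul_assoc]
    · rw [map_mul, map_natCast, ← mul_assoc, mul_assoc (i : WW R), (Nat.cast_commute i _).eq]

theorem tau_rep (w : WW R) : ∀ g, tau (rep R w g) = w * tau g := by
  induction w using weyl_induction with
  | hc r =>
    intro g
    rw [AlgHom.commutes, Module.algebraMap_end_apply, tau_smul, Algebra.smul_def]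
  | hx => intro g; rw [rep_x, tau_opX]
  | hy => intro g; rw [rep_y, tau_opY]
  | ha a b h1 h2 => intro g; simp [tau_add, h1, h2, add_mul]
  | hm a b h1 h2 => intro g; simp [Module.End.mul_apply, h1, h2, mul_assoc]

theorem tau_sym (w : WW R) : tau (sym R w) = w := by
  rw [sym_apply, tau_rep]
  rw [show (1 : R[X][X]) = monomial 0 1 from rfl, tau_monomial]; simp

theorem rep_xpow (i : ℕ) (g : R[X][X]) : rep R (wx R ^ i) g = X ^ i * g := by
  induction i with
  | zero => simp
  | succ n ih => rw [pow_succ', map_mul, Module.End.mul_apply, ih, rep_x, opX_apply]; ring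

theorem rep_aeval_C (a b : R[X]) : rep R (aeval (wy R) a) (C b) = C (a * b) := by
  induction a using Polynomial.induction_on' with
  | add f g hf hg => simp only [map_add, LinearMap.add_apply, hf, hg, add_mul]
  | monomial i r =>
    rw [aeval_monomial, map_mul, AlgHom.commutes, Module.End.mul_apply]
    have : rep R (wy R ^ i) (C b) = C (X ^ i * b) := by
      induction i with
      | zero => simp
      | succ n ih =>
        rw [pow_succ', map_mul, Module.End.mul_apply, ih, rep_y, opY_apply, derivative_C, add_zero,
          ← C_mul, pow_succ', mul_assoc]
    rw [this, Module.algebraMap_end_apply, ← C_mul_X_pow_eq_monomial, Polynomial.smul_C,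
      Polynomial.smul_eq_C_mul, mul_assoc]

theorem sym_mon (i : ℕ) (a : R[X]) : sym R (wx R ^ i * aeval (wy R) a) = monomial i a := by
  rw [sym_mul, sym_apply, show (1 : R[X][X]) = C 1 from rfl, rep_aeval_C, rep_xpow, mul_one,
    mul_comm, C_mul_X_pow_eq_monomial]

theorem sym_tau (g : R[X][X]) : sym R (tau g) = g := by
  induction g using Polynomial.induction_on' with
  | add f g hf hg => rw [tau_add, map_add, hf, hg]
  | monomial i a => rw [tau_monomial, sym_mon]

theorem sym_inj : Function.Injective (sym R) := Function.LeftInverse.injective tau_sym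

def cf (w : WW R) (i j : ℕ) : R := ((sym R w).coeff i).coeff j

theorem cf_ext {v w : WW R} (h : ∀ i j, cf v i j = cf w i j) : v = w := by
  apply sym_inj; ext i j; exact h i j

theorem cf_add (v w : WW R) (i j : ℕ) : cf (v + w) i j = cf v i j + cf w i j := by
  simp [cf]
theorem cf_smul (r : R) (w : WW R) (i j : ℕ) : cf (r • w) i j = r * cf w i j := by
  simp [cf]
theorem cf_sub (v w : WW R) (i j : ℕ) : cf (v - w) i j = cf v i j - cf w i j := by
  simp [cf]
theorem cf_zero (i j : ℕ) : cf (0 : WW R) i j = 0 := by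
  simp [cf]
theorem cf_xy (a b i j : ℕ) : cf (wx R ^ a * wy R ^ b) i j = if a = i ∧ b = j then 1 else 0 := by
  have := sym_mon (R := R) a (X ^ b)
  rw [map_pow, aeval_X] at this
  rw [cf, this, coeff_monomial]
  split_ifs with h1 h2 h2
  · simp [h2.2]
  · simp only [h1, true_and] at h2
    simp [coeff_X_pow, Ne.symm h2]
  · exact absurd h2.1 h1
  · simp

/-- induction on monomials -/
theorem weyl_mon_induction {p : WW R → Prop} (ha : ∀ a b, p a → p b → p (a + b))
    (hm : ∀ (r : R) i j, p (r • (wx R ^ i * wy R ^ j))) (w : WW R) : p w := by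
  rw [← tau_sym w]
  induction sym R w using Polynomial.induction_on' with
  | add f g hf hg => rw [tau_add]; exact ha _ _ hf hg
  | monomial i a =>
    induction a using Polynomial.induction_on' with
    | add f g hf hg =>
      rw [map_add, tau_add]; exact ha _ _ hf hg
    | monomial j r =>
      rw [tau_monomial, aeval_monomial]
      have := hm r i j
      rwa [Algebra.smul_def, ← mul_assoc, (Algebra.commutes r (wx R ^ i)), mul_assoc] at this

/-- top X-degree coefficients multiply -/
theorem rep_y_top (n : ℕ) (g : R[X][X]) (hg : g.natDegree ≤ n) (j : ℕ) :
    (rep R (wy R ^ j) g).natDegree ≤ n ∧ (rep R (wy R ^ j) g).coeff n = X ^ j * g.coeff n := by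
  induction j with
  | zero => simp [hg]
  | succ j ih =>
    rw [pow_succ', map_mul, Module.End.mul_apply, rep_y, opY_apply]
    set q := rep R (wy R ^ j) g
    obtain ⟨h1, h2⟩ := ih
    constructor
    · refine (natDegree_add_le _ _).trans (max_le ?_ ?_)
      · exact (natDegree_C_mul_le _ _).trans h1
      · exact (natDegree_derivative_le _).trans (by omega)
    · rw [coeff_add, coeff_C_mul, h2, coeff_derivative, coeff_eq_zero_of_natDegree_lt (p := q) (n := n + 1) (by omega)]
      ring

theorem rep_aeval_top (n : ℕ) (g : R[X][X]) (hg : g.natDegree ≤ n) (a : R[X]) :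
    (rep R (aeval (wy R) a) g).natDegree ≤ n ∧
      (rep R (aeval (wy R) a) g).coeff n = a * g.coeff n := by
  induction a using Polynomial.induction_on' with
  | add f h hf hg =>
    simp only [map_add, LinearMap.add_apply]
    exact ⟨(natDegree_add_le _ _).trans (max_le hf.1 hg.1), by rw [coeff_add, hf.2, hg.2, add_mul]⟩
  | monomial j r =>
    rw [aeval_monomial, map_mul, AlgHom.commutes, Module.End.mul_apply]
    obtain ⟨h1, h2⟩ := rep_y_top n g hg j
    rw [Module.algebraMap_end_apply]
    refine ⟨(natDegree_smul_le _ _).trans h1, ?_⟩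
    rw [coeff_smul, h2, ← C_mul_X_pow_eq_monomial, Polynomial.smul_eq_C_mul, mul_assoc]

theorem rep_top (m n : ℕ) (f g : R[X][X]) (hf : f.natDegree ≤ m) (hg : g.natDegree ≤ n) :
    (rep R (tau f) g).natDegree ≤ m + n ∧
      (rep R (tau f) g).coeff (m + n) = f.coeff m * g.coeff n := by
  have key : rep R (tau f) g = ∑ i ∈ Finset.range (m + 1),
      X ^ i * rep R (aeval (wy R) (f.coeff i)) g := by
    have : tau f = ∑ i ∈ Finset.range (m + 1), wx R ^ i * aeval (wy R) (f.coeff i) := by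
      unfold tau
      rw [Polynomial.sum_over_range' _ _ (m+1) (by omega)]
      intro i; simp
    rw [this, map_sum, LinearMap.sum_apply]
    refine Finset.sum_congr rfl fun i _ => ?_
    rw [map_mul, Module.End.mul_apply, rep_xpow]
  rw [key]
  constructor
  · refine natDegree_sum_le_of_forall_le _ _ fun i hi => ?_
    refine natDegree_mul_le.trans ?_
    have := (rep_aeval_top n g hg (f.coeff i)).1
    have h3 := natDegree_X_pow_le (R := R[X]) i
    simp at hi
    omega
  · rw [finsetSum_coeff, Finset.sum_eq_single m]
    · rw [add_comm m n, coeff_X_pow_mul, (rep_aeval_top n g hg _).2]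
    · intro i hi hne
      simp at hi
      apply coeff_eq_zero_of_natDegree_lt
      refine natDegree_mul_le.trans_lt ?_
      have := (rep_aeval_top n g hg (f.coeff i)).1
      have h3 := natDegree_X_pow_le (R := R[X]) i
      omega
    · simp

theorem sym_mul_top (m n : ℕ) (v w : WW R) (hf : (sym R v).natDegree ≤ m)
    (hg : (sym R w).natDegree ≤ n) :
    (sym R (v * w)).natDegree ≤ m + n ∧
      (sym R (v * w)).coeff (m + n) = (sym R v).coeff m * (sym R w).coeff n := by
  have := rep_top m n (sym R v) (sym R w) hf hg
  rwa [tau_sym, ← sym_mul] at this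

theorem sym_one : sym R 1 = 1 := by simp [sym_apply]

theorem sym_mul_natDegree [IsDomain R] {v w : WW R} (hv : v ≠ 0) (hw : w ≠ 0) :
    v * w ≠ 0 ∧ (sym R (v * w)).natDegree = (sym R v).natDegree + (sym R w).natDegree := by
  obtain ⟨h1, h2⟩ := sym_mul_top _ _ v w le_rfl le_rfl
  have hv' : sym R v ≠ 0 := fun h => hv (sym_inj (by simpa using h))
  have hw' : sym R w ≠ 0 := fun h => hw (sym_inj (by simpa using h))
  have h3 : (sym R (v * w)).coeff ((sym R v).natDegree + (sym R w).natDegree) ≠ 0 := by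
    rw [h2]; exact mul_ne_zero (leadingCoeff_ne_zero.2 hv') (leadingCoeff_ne_zero.2 hw')
  refine ⟨?_, le_antisymm h1 (le_natDegree_of_ne_zero h3)⟩
  intro h; rw [h] at h3; simp at h3

theorem sym_pow_natDegree [IsDomain R] {v : WW R} (hv : v ≠ 0) (n : ℕ) :
    v ^ n ≠ 0 ∧ (sym R (v ^ n)).natDegree = n * (sym R v).natDegree := by
  induction n with
  | zero =>
    rw [pow_zero, sym_one]
    refine ⟨fun h => ?_, by simp⟩
    have := congrArg (sym R) h
    rw [sym_one] at this; simp at this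
  | succ n ih =>
    have := sym_mul_natDegree ih.1 hv
    rw [pow_succ]
    exact ⟨this.1, by rw [this.2, ih.2]; ring⟩

theorem weyl_mul_eq_zero [IsDomain R] {v w : WW R} (h : v * w = 0) : v = 0 ∨ w = 0 := by
  by_contra hh
  push Not at hh
  exact (sym_mul_natDegree hh.1 hh.2).1 h

/-- Y-degree bounds -/
def ydeg (m : ℕ) (g : R[X][X]) : Prop := ∀ i, (g.coeff i).natDegree ≤ m

theorem ydeg_opY {m : ℕ} {g : R[X][X]} (h : ydeg m g) : ydeg (m + 1) (opY R g) := by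
  intro i
  rw [opY_apply, coeff_add, coeff_C_mul, coeff_derivative]
  refine (natDegree_add_le _ _).trans (max_le ?_ ?_)
  · refine natDegree_mul_le.trans ?_
    have := h i; have := natDegree_X_le (R := R); omega
  · refine natDegree_mul_le.trans ?_
    have := h (i+1)
    have h3 : ((i : R[X]) + 1).natDegree = 0 := by
      rw [← Nat.cast_add_one]; exact natDegree_natCast _
    omega

theorem ydeg_mono {m n : ℕ} {g : R[X][X]} (h : ydeg m g) (hmn : m ≤ n) : ydeg n g :=
  fun i => (h i).trans hmn

theorem ydeg_Xpow {m : ℕ} {g : R[X][X]} (h : ydeg m g) (k : ℕ) : ydeg m (X ^ k * g) := by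
  intro i
  rw [coeff_X_pow_mul']
  split_ifs
  · exact h _
  · simp

theorem ydeg_add {m : ℕ} {f g : R[X][X]} (h : ydeg m f) (h' : ydeg m g) : ydeg m (f + g) := by
  intro i
  rw [coeff_add]
  exact (natDegree_add_le _ _).trans (max_le (h i) (h' i))

theorem ydeg_sum {ι : Type} (s : Finset ι) {m : ℕ} {f : ι → R[X][X]} (h : ∀ i ∈ s, ydeg m (f i)) :
    ydeg m (∑ i ∈ s, f i) := by
  intro i
  rw [finsetSum_coeff]
  exact natDegree_sum_le_of_forall_le _ _ fun k hk => h k hk i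

theorem ydeg_rep_aeval {m n : ℕ} {g : R[X][X]} (h : ydeg n g) (a : R[X]) (ha : a.natDegree ≤ m) :
    ydeg (m + n) (rep R (aeval (wy R) a) g) := by
  rw [aeval_eq_sum_range' (Nat.lt_succ_of_le ha), map_sum, LinearMap.sum_apply]
  apply ydeg_sum
  intro j hj
  have hp : ∀ j, ydeg (j + n) (rep R (wy R ^ j) g) := by
    intro j
    induction j with
    | zero => simpa using h
    | succ j ih =>
      rw [pow_succ', map_mul, Module.End.mul_apply, rep_y]
      exact ydeg_mono (ydeg_opY ih) (by omega)
  have hj' : j + n ≤ m + n := by simp at hj; omega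
  intro i
  rw [map_smul, LinearMap.smul_apply, coeff_smul]
  exact (natDegree_smul_le _ _).trans (ydeg_mono (hp j) hj' i)

theorem ydeg_mul {m n : ℕ} {v w : WW R} (hv : ydeg m (sym R v)) (hw : ydeg n (sym R w)) :
    ydeg (m + n) (sym R (v * w)) := by
  rw [sym_mul]
  conv => arg 2; rw [← tau_sym v]
  unfold tau Polynomial.sum
  rw [map_sum, LinearMap.sum_apply]
  apply ydeg_sum
  intro i _
  rw [map_mul, Module.End.mul_apply, rep_xpow]
  exact ydeg_Xpow (ydeg_rep_aeval hw _ (hv i)) _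

theorem ydeg_pow {m : ℕ} {v : WW R} (hv : ydeg m (sym R v)) (n : ℕ) :
    ydeg (n * m) (sym R (v ^ n)) := by
  induction n with
  | zero =>
    intro i
    rw [pow_zero, sym_one, coeff_one]; split_ifs <;> simp
  | succ n ih =>
    rw [pow_succ]
    exact ydeg_mono (ydeg_mul ih hv) (by rw [Nat.succ_mul])

end WeylBasics
end

noncomputable section
open Polynomial

section WeylMap
variable {R S : Type} [CommRing R] [CommRing S]

def weylMap (φ : R →+* S) : WW R →+* WW S :=
  let _ : Algebra R (WW S) := ((algebraMap S (WW S)).comp φ).toAlgebra'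
    (fun c x => Algebra.commutes (R := S) (φ c) x)
  (weylLift R (wx S) (wy S) (Wyx S)).toRingHom

@[simp] theorem weylMap_x (φ : R →+* S) : weylMap φ (wx R) = wx S := by
  let _ : Algebra R (WW S) := ((algebraMap S (WW S)).comp φ).toAlgebra'
    (fun c x => Algebra.commutes (R := S) (φ c) x)
  exact weylLift_x R (wx S) (wy S) (Wyx S)

@[simp] theorem weylMap_y (φ : R →+* S) : weylMap φ (wy R) = wy S := by
  let _ : Algebra R (WW S) := ((algebraMap S (WW S)).comp φ).toAlgebra'
    (fun c x => Algebra.commutes (R := S) (φ c) x)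
  exact weylLift_y R (wx S) (wy S) (Wyx S)

theorem weylMap_algebraMap (φ : R →+* S) (r : R) :
    weylMap φ (algebraMap R _ r) = algebraMap S _ (φ r) := by
  let _ : Algebra R (WW S) := ((algebraMap S (WW S)).comp φ).toAlgebra'
    (fun c x => Algebra.commutes (R := S) (φ c) x)
  exact (weylLift R (wx S) (wy S) (Wyx S)).commutes r

theorem weylMap_smul (φ : R →+* S) (r : R) (w : WW R) :
    weylMap φ (r • w) = φ r • weylMap φ w := by
  rw [Algebra.smul_def, map_mul, weylMap_algebraMap, ← Algebra.smul_def]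

theorem cf_weylMap (φ : R →+* S) (w : WW R) (i j : ℕ) :
    cf (weylMap φ w) i j = φ (cf w i j) := by
  induction w using weyl_mon_induction with
  | ha a b h1 h2 => rw [map_add, cf_add, cf_add, map_add, h1, h2]
  | hm r a b =>
    rw [weylMap_smul, map_mul, map_pow, map_pow, weylMap_x, weylMap_y, cf_smul, cf_smul, cf_xy,
      cf_xy, map_mul]
    split_ifs <;> simp

theorem weylMap_inj (φ : R →+* S) (h : Function.Injective φ) :
    Function.Injective (weylMap φ) := by
  intro v w hvw
  apply cf_ext
  intro i j
  apply h
  rw [← cf_weylMap, hvw, cf_weylMap]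

variable (R) in
def betaHom : WW R →ₐ[R] (WW R)ᵐᵒᵖ :=
  weylLift R (MulOpposite.op (wx R)) (MulOpposite.op (-(wy R))) (by
    rw [← MulOpposite.op_mul, ← MulOpposite.op_mul, ← MulOpposite.op_one, ← MulOpposite.op_add]
    congr 1
    rw [neg_mul, Wyx, mul_neg]; abel)

def beta (w : WW R) : WW R := (betaHom R w).unop

@[simp] theorem beta_x : beta (wx R) = wx R := by simp [beta, betaHom]
@[simp] theorem beta_y : beta (wy R) = -wy R := by
  unfold beta betaHom; rw [weylLift_y]; rfl
theorem beta_mul (v w : WW R) : beta (v * w) = beta w * beta v := by simp [beta]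
theorem beta_add (v w : WW R) : beta (v + w) = beta v + beta w := by simp [beta]
theorem beta_neg (v : WW R) : beta (-v) = -beta v := by
  unfold beta; rw [map_neg]; rfl
theorem beta_smul (r : R) (w : WW R) : beta (r • w) = r • beta w := by simp [beta]
theorem beta_one : beta (1 : WW R) = 1 := by simp [beta]
theorem beta_zero : beta (0 : WW R) = 0 := by simp [beta]
theorem beta_algebraMap (r : R) : beta (algebraMap R (WW R) r) = algebraMap R _ r := by
  unfold beta; rw [AlgHom.commutes]; rfl
theorem beta_pow (w : WW R) (n : ℕ) : beta (w ^ n) = beta w ^ n := by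
  simp [beta]

theorem weylMap_beta (φ : R →+* S) (w : WW R) : weylMap φ (beta w) = beta (weylMap φ w) := by
  induction w using weyl_induction with
  | hc r => rw [beta_algebraMap, weylMap_algebraMap, beta_algebraMap]
  | hx => simp
  | hy => simp
  | ha a b h1 h2 => rw [beta_add, map_add, h1, h2, map_add, beta_add]
  | hm a b h1 h2 => rw [beta_mul, map_mul, h1, h2, map_mul, beta_mul]

end WeylMap

section Comm
variable {R : Type} [CommRing R]

theorem gen_y_mul_xpow {A : Type} [Ring A] {x y : A} (h : y * x = x * y + 1) (i : ℕ) :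
    y * x ^ i = x ^ i * y + i * x ^ (i - 1) := by
  let _ : Algebra ℤ A := inferInstance
  have := congrArg (weylLift ℤ x y h) (y_mul_xpow (R := ℤ) i)
  simpa using this

theorem gen_ypow_mul_x {A : Type} [Ring A] {x y : A} (h : y * x = x * y + 1) (i : ℕ) :
    y ^ i * x = x * y ^ i + i * y ^ (i - 1) := by
  induction i with
  | zero => simp
  | succ n ih =>
    rw [pow_succ, mul_assoc, h, mul_add, ← mul_assoc, ih, add_mul, mul_assoc, mul_one]
    rcases n with _ | n
    · simp
    · simp [pow_succ, mul_assoc, add_mul]; abel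

theorem cf_comm_y (w : WW R) (i j : ℕ) :
    cf (wy R * w - w * wy R) i j = (i + 1) * cf w (i + 1) j := by
  induction w using weyl_mon_induction with
  | ha a b h1 h2 =>
    rw [mul_add, add_mul, add_sub_add_comm, cf_add, h1, h2, cf_add, mul_add]
  | hm r a b =>
    have : wy R * (r • (wx R ^ a * wy R ^ b)) - (r • (wx R ^ a * wy R ^ b)) * wy R =
        (r * a) • (wx R ^ (a - 1) * wy R ^ b) := by
      rw [mul_smul_comm, smul_mul_assoc, ← smul_sub, ← mul_assoc, y_mul_xpow, add_mul,
        mul_assoc, ← pow_succ', mul_assoc _ _ (wy R), ← pow_succ, add_sub_cancel_left, mul_smul,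
        mul_assoc, ← nsmul_eq_mul, Nat.cast_smul_eq_nsmul]
    rw [this, cf_smul, cf_smul, cf_xy, cf_xy]
    rcases a with _ | a
    · simp
    · by_cases h : a = i
      · subst h; simp; split_ifs <;> ring
      · simp [h]

theorem cf_comm_x (w : WW R) (i j : ℕ) :
    cf (w * wx R - wx R * w) i j = (j + 1) * cf w i (j + 1) := by
  induction w using weyl_mon_induction with
  | ha a b h1 h2 =>
    rw [mul_add, add_mul, add_sub_add_comm, cf_add, h1, h2, cf_add, mul_add]
  | hm r a b =>
    have : (r • (wx R ^ a * wy R ^ b)) * wx R - wx R * (r • (wx R ^ a * wy R ^ b)) =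
        (r * b) • (wx R ^ a * wy R ^ (b - 1)) := by
      rw [mul_smul_comm, smul_mul_assoc, ← smul_sub, mul_assoc, gen_ypow_mul_x (Wyx R), mul_add,
        ← mul_assoc, ← pow_succ, ← mul_assoc (wx R), ← pow_succ', add_sub_cancel_left, mul_smul,
        ← nsmul_eq_mul, mul_smul_comm, Nat.cast_smul_eq_nsmul]
    rw [this, cf_smul, cf_smul, cf_xy, cf_xy]
    rcases b with _ | b
    · simp
    · by_cases h : b = j
      · subst h; simp; split_ifs <;> ring
      · simp [h]

/-- `Y^ℓ X^ℓ` modulo `ℓ²`. -/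
theorem ypow_xpow_sq (l : ℕ) (hl : l.Prime) (h0 : (l : R) ^ 2 = 0) :
    wy R ^ l * wx R ^ l = wx R ^ l * wy R ^ l + algebraMap R _ (l.factorial : R) := by
  apply sym_inj
  have h1 : sym R (wx R ^ l * wy R ^ l) = X ^ l * C X ^ l := by
    have := sym_mon (R := R) l (X ^ l)
    rw [map_pow, aeval_X] at this
    rw [this, ← C_mul_X_pow_eq_monomial]; simp [mul_comm]
  have h2 : sym R (algebraMap R (WW R) (l.factorial : R)) = (l.factorial : R[X][X]) := by
    rw [sym_apply, AlgHom.commutes, Module.algebraMap_end_apply, Nat.cast_smul_eq_nsmul,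
      nsmul_eq_mul, mul_one]
  have h3 : sym R (wx R ^ l) = X ^ l := by rw [sym_apply, rep_xpow, mul_one]
  rw [map_add, h1, h2, sym_mul, h3, map_pow (rep R), rep_y]
  have hc : Commute (LinearMap.mulLeft R (C X : R[X][X]))
      ((derivative (R := R[X])).restrictScalars R) := by
    ext1 g
    simp [Module.End.mul_apply]
  unfold opY
  rw [hc.add_pow, LinearMap.sum_apply]
  have hterm : ∀ m, ((LinearMap.mulLeft R (C X : R[X][X])) ^ m *
      ((derivative (R := R[X])).restrictScalars R) ^ (l - m) * ((l.choose m : ℕ) : Module.End R R[X][X]))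
      (X ^ l) = C X ^ m * (((l.choose m * l.descFactorial (l - m) : ℕ) : R[X][X]) * X ^ (l - (l - m))) := by
    intro m
    rw [Module.End.mul_apply, Module.End.mul_apply, LinearMap.pow_mulLeft,
      LinearMap.mulLeft_apply, Module.End.natCast_apply, map_nsmul]
    congr 1
    have : ((((derivative (R := R[X])).restrictScalars R) ^ (l - m) : Module.End R R[X][X]))
        (X ^ l) = derivative^[l - m] (X ^ l) := by
      rw [Module.End.pow_apply]; rfl
    rw [this, iterate_derivative_X_pow_eq_natCast_mul, nsmul_eq_mul]
    push_cast; ring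
  rw [Finset.sum_congr rfl (fun m _ => hterm m), Finset.sum_range_succ]
  have hl0 : 0 < l := hl.pos
  obtain ⟨k, rfl⟩ : ∃ k, l = k + 1 := ⟨l - 1, by omega⟩
  rw [Finset.sum_range_succ', Finset.sum_eq_zero]
  · have e : (k + 1).descFactorial (k + 1 - 0) = (k + 1).factorial := by
      rw [Nat.sub_zero, Nat.descFactorial_self]
    rw [e]
    simp only [Nat.choose_zero_right, Nat.choose_self, Nat.sub_self, Nat.sub_zero,
      Nat.descFactorial_zero, pow_zero, one_mul, Nat.cast_one, mul_one, zero_add]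
    ring
  · intro m hm
    simp only [Finset.mem_range] at hm
    have d1 : (k+1) ∣ (k+1).choose (m+1) := hl.dvd_choose_self (by omega) (by omega)
    have d2 : (k+1) ∣ (k+1).descFactorial (k + 1 - (m+1)) := by
      obtain ⟨j, hj⟩ : ∃ j, k + 1 - (m + 1) = j + 1 := ⟨k - m - 1, by omega⟩
      rw [hj, Nat.succ_descFactorial_succ]
      exact dvd_mul_right _ _
    obtain ⟨u, hu⟩ := mul_dvd_mul d1 d2
    rw [hu]
    have : (((k + 1) * (k + 1) * u : ℕ) : R[X][X]) = C (C (((k+1 : ℕ) : R) ^ 2 * u)) := by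
      push_cast; simp [pow_two]
    rw [this, h0]; simp

/-- generic -/
theorem gen_ypow_xpow_sq (l : ℕ) (hl : l.Prime) (h0 : (l : R) ^ 2 = 0) {a b : WW R}
    (h : b * a = a * b + 1) :
    b ^ l * a ^ l = a ^ l * b ^ l + algebraMap R _ (l.factorial : R) := by
  have := congrArg (weylLift R a b h) (ypow_xpow_sq (R := R) l hl h0)
  simp only [map_mul, map_pow, weylLift_x, weylLift_y, map_add, AlgHom.commutes] at this
  exact this

end Comm
end

noncomputable section
open Polynomial

section Central

theorem li_aux {A : Type} [Ring A] {a b : A} (h : b * a = a * b + 1) (l : ℕ)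
    (hinv : ∀ k : ℕ, 0 < k → k < l → ∀ c : A, (k : A) * c = 0 → c = 0) (n : ℕ) :
    ∀ (_ : n ≤ l) (c : ℕ → A) (_ : ∀ i, b * c i = c i * b)
      (_ : ∑ i ∈ Finset.range n, a ^ i * c i = 0), ∀ i < n, c i = 0 := by
  induction n with
  | zero => intro _ _ _ _ i hi; omega
  | succ n ih =>
    intro hn c hc hs
    have h1 : ∑ i ∈ Finset.range (n + 1), (i : A) * (a ^ (i - 1) * c i) = 0 := by
      have e : ∀ i : ℕ, (i : A) * (a ^ (i - 1) * c i) = b * (a ^ i * c i) - (a ^ i * c i) * b := by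
        intro i
        rw [← mul_assoc b, gen_y_mul_xpow h, add_mul, mul_assoc _ b, hc, ← mul_assoc (a ^ i) (c i) b,
          add_sub_cancel_left, mul_assoc]
      rw [Finset.sum_congr rfl (fun i _ => e i), Finset.sum_sub_distrib, ← Finset.mul_sum,
        ← Finset.sum_mul, hs]
      simp
    rw [Finset.sum_range_succ'] at h1
    simp only [Nat.cast_zero, zero_mul, add_zero, Nat.add_sub_cancel] at h1
    have h2 := ih (by omega) (fun i => ((i + 1 : ℕ) : A) * c (i + 1)) (by
      intro i
      rw [← mul_assoc, ← (Nat.cast_commute (i+1) b).eq, mul_assoc, hc, mul_assoc]) (by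
      rw [← h1]
      refine Finset.sum_congr rfl fun i _ => ?_
      rw [← mul_assoc, ← mul_assoc, (Nat.cast_commute (i+1) (a ^ i)).eq])
    have h3 : ∀ i < n, c (i + 1) = 0 := fun i hi => hinv (i+1) (by omega) (by omega) _ (h2 i hi)
    have h0 : c 0 = 0 := by
      rw [Finset.sum_range_succ', Finset.sum_eq_zero] at hs
      · simpa using hs
      · intro i hi
        rw [h3 i (Finset.mem_range.1 hi), mul_zero]
    intro i hi
    rcases i with _ | i
    · exact h0
    · exact h3 i (by omega)

instance {R : Type} [CommRing R] [Nontrivial R] : Nontrivial (WW R) :=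
  ⟨⟨1, 0, fun h => by
    have := congrArg (sym R) h
    rw [sym_one, map_zero] at this
    exact one_ne_zero this⟩⟩

variable {F : Type} [Field F] (l : ℕ) [hl : Fact l.Prime] [CharP F l]

theorem weyl_hinv (k : ℕ) (h0 : 0 < k) (hk : k < l) (c : WW F) (hc : (k : WW F) * c = 0) : c = 0 := by
  have hk' : (k : F) ≠ 0 := by
    rw [Ne, CharP.cast_eq_zero_iff F l]
    exact Nat.not_dvd_of_pos_of_lt h0 hk
  rw [← nsmul_eq_mul, ← Nat.cast_smul_eq_nsmul F] at hc
  have := congrArg (fun w => (k : F)⁻¹ • w) hc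
  simpa [smul_smul, hk'] using this

theorem weyl_l_zero : ((l : ℕ) : WW F) = 0 := by
  have : ((l : ℕ) : WW F) = algebraMap F (WW F) (l : F) := (map_natCast _ _).symm
  rw [this, CharP.cast_eq_zero]; simp

theorem weyl_central_of {z : WW F} (hx : z * wx F = wx F * z) (hy : z * wy F = wy F * z) :
    ∀ w, w * z = z * w := by
  intro w
  induction w using weyl_induction with
  | hc r => exact Algebra.commutes r z
  | hx => exact hx.symm
  | hy => exact hy.symm
  | ha a b h1 h2 => rw [add_mul, mul_add, h1, h2]
  | hm a b h1 h2 => rw [mul_assoc, h2, ← mul_assoc, h1, mul_assoc]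

theorem pow_l_comm {a b : WW F} (h : b * a = a * b + 1) : b * a ^ l = a ^ l * b := by
  rw [gen_y_mul_xpow h, weyl_l_zero]; simp

theorem pow_l_comm' {a b : WW F} (h : b * a = a * b + 1) : b ^ l * a = a * b ^ l := by
  rw [gen_ypow_mul_x h, weyl_l_zero]; simp

theorem xl_central : wx F ^ l ∈ Subring.center (WW F) := by
  rw [Subring.mem_center_iff]
  refine weyl_central_of ?_ ?_
  · rw [← pow_succ, ← pow_succ']
  · rw [pow_l_comm l (Wyx F)]

theorem yl_central : wy F ^ l ∈ Subring.center (WW F) := by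
  rw [Subring.mem_center_iff]
  refine weyl_central_of ?_ ?_
  · rw [pow_l_comm' l (Wyx F)]
  · rw [← pow_succ, ← pow_succ']

theorem weyl_span : Submodule.span (Subring.center (WW F))
    (Set.range fun p : Fin l × Fin l => wx F ^ (p.1 : ℕ) * wy F ^ (p.2 : ℕ)) = ⊤ := by
  rw [eq_top_iff]
  intro w _
  have hlp := hl.out.pos
  induction w using weyl_mon_induction with
  | ha a b h1 h2 => exact Submodule.add_mem _ (h1 trivial) (h2 trivial)
  | hm r i j =>
    have hr : algebraMap F (WW F) r ∈ Subring.center (WW F) := by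
      rw [Subring.mem_center_iff]; intro g; exact (Algebra.commutes r g).symm
    let z : Subring.center (WW F) := ⟨_, hr⟩ * ⟨_, xl_central l⟩ ^ (i / l) * ⟨_, yl_central l⟩ ^ (j / l)
    have e : r • (wx F ^ i * wy F ^ j) = z • (wx F ^ (i % l) * wy F ^ (j % l)) := by
      rw [Subring.smul_def, smul_eq_mul]
      simp only [z, Subring.coe_mul, Subring.coe_pow]
      rw [Algebra.smul_def, mul_assoc, mul_assoc]
      congr 1
      have hc := Subring.mem_center_iff.1 (Subring.pow_mem _ (yl_central (F := F) l) (j / l)) (wx F ^ (i % l))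
      rw [← mul_assoc ((wy F ^ l) ^ (j / l)), ← hc, ← mul_assoc, ← mul_assoc, mul_assoc,
        ← pow_mul, ← pow_mul, ← pow_add, ← pow_add, Nat.div_add_mod, Nat.div_add_mod]
    rw [e]
    apply Submodule.smul_mem
    apply Submodule.subset_span
    exact ⟨(⟨i % l, Nat.mod_lt _ hlp⟩, ⟨j % l, Nat.mod_lt _ hlp⟩), rfl⟩

theorem weyl_li {a b : WW F} (h : b * a = a * b + 1) (g : Fin l × Fin l → Subring.center (WW F))
    (hg : ∑ p, g p • (a ^ (p.1 : ℕ) * b ^ (p.2 : ℕ)) = 0) : ∀ p, g p = 0 := by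
  have hlp := hl.out.pos
  let G : ℕ → ℕ → WW F := fun i j => if hh : i < l ∧ j < l then g (⟨i, hh.1⟩, ⟨j, hh.2⟩) else 0
  have hGc : ∀ i j w, w * G i j = G i j * w := by
    intro i j w
    simp only [G]
    split_ifs with hh
    · exact Subring.mem_center_iff.1 (g (⟨i, hh.1⟩, ⟨j, hh.2⟩)).2 w
    · simp
  have h1 : ∑ i ∈ Finset.range l, a ^ i * (∑ j ∈ Finset.range l, b ^ j * G i j) = 0 := by
    rw [← hg, Fintype.sum_prod_type, Finset.sum_range]
    refine Finset.sum_congr rfl fun i _ => ?_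
    rw [Finset.sum_range, Finset.mul_sum]
    refine Finset.sum_congr rfl fun j _ => ?_
    rw [Subring.smul_def, smul_eq_mul, ← mul_assoc, hGc]
    simp [G]
  have h2 := li_aux h l (weyl_hinv l) l le_rfl _ (fun i => by
    rw [Finset.mul_sum, Finset.sum_mul]
    refine Finset.sum_congr rfl fun j _ => ?_
    rw [← mul_assoc, ← pow_succ', mul_assoc, ← hGc, ← mul_assoc, ← pow_succ]) h1
  rintro ⟨i, j⟩
  have h' : (-a) * b = b * (-a) + 1 := by
    rw [neg_mul, mul_neg, h]; abel
  have h3 := li_aux h' l (weyl_hinv l) l le_rfl (fun j => G i j) (fun j => hGc _ _ _) (h2 i i.2) j j.2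
  apply Subtype.ext
  simpa [G] using h3

theorem bpow_central (l : ℕ) [hl : Fact l.Prime] [CharP F l] {a b : WW F} (h : b * a = a * b + 1) (z : WW F) (hza : z * a = a * z)
    (hzb : z * b = b * z) : z ∈ Subring.center (WW F) := by
  rw [Subring.mem_center_iff]
  intro w
  let v : Option (Fin l × Fin l) → WW F := fun o => o.elim w fun p => a ^ (p.1 : ℕ) * b ^ (p.2 : ℕ)
  have hnl : ¬ LinearIndependent (Subring.center (WW F)) v := by
    intro hli
    classical
    have := linearIndependent_le_span_finset v hli
      (Finset.univ.image fun p : Fin l × Fin l => wx F ^ (p.1 : ℕ) * wy F ^ (p.2 : ℕ)) (by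
        simpa using weyl_span (F := F) l)
    have h2 : Cardinal.mk (Option (Fin l × Fin l)) ≤ (l * l : ℕ) := by
      refine this.trans ?_
      norm_cast
      refine Finset.card_image_le.trans ?_
      simp
    simp at h2
    norm_cast at h2
    omega
  rw [Fintype.not_linearIndependent_iff] at hnl
  obtain ⟨g, hg, hne⟩ := hnl
  rw [Fintype.sum_option] at hg
  simp only [v, Option.elim] at hg
  have hs : g none ≠ 0 := by
    intro hs
    rw [hs, zero_smul, zero_add] at hg
    have := weyl_li l h (fun p => g (some p)) hg
    obtain ⟨o, ho⟩ := hne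
    rcases o with _ | p
    · exact ho hs
    · exact ho (this p)
  have hzp : ∀ n, z * a ^ n = a ^ n * z := fun n => (Commute.pow_right hza n)
  have hzq : ∀ n, z * b ^ n = b ^ n * z := fun n => (Commute.pow_right hzb n)
  have hS : ∀ (c : Subring.center (WW F)) (u : WW F), z * u = u * z → z * (c • u) = (c • u) * z := by
    intro c u hu
    rw [Subring.smul_def, smul_eq_mul, ← mul_assoc, (Subring.mem_center_iff.1 c.2 z), mul_assoc, hu,
      mul_assoc]
  have hT : z * (g none • w) = (g none • w) * z := by
    rw [eq_neg_of_add_eq_zero_left hg, mul_neg, neg_mul, Finset.mul_sum, Finset.sum_mul]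
    congr 1
    refine Finset.sum_congr rfl fun p _ => hS _ _ ?_
    rw [← mul_assoc, hzp, mul_assoc, hzq, mul_assoc]
  rw [Subring.smul_def, smul_eq_mul, ← mul_assoc, (Subring.mem_center_iff.1 (g none).2 z), mul_assoc,
    mul_assoc, ← sub_eq_zero, ← mul_sub] at hT
  rcases weyl_mul_eq_zero hT with h0 | h0
  · exact absurd (Subtype.ext h0) hs
  · exact (sub_eq_zero.1 h0).symm

theorem bl_central {a b : WW F} (h : b * a = a * b + 1) :
    a ^ l ∈ Subring.center (WW F) ∧ b ^ l ∈ Subring.center (WW F) := by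
  constructor
  · refine bpow_central l h _ ?_ ?_
    · rw [← pow_succ, ← pow_succ']
    · rw [pow_l_comm l h]
  · refine bpow_central l h _ ?_ ?_
    · rw [pow_l_comm' l h]
    · rw [← pow_succ, ← pow_succ']

theorem cf_central {z : WW F} (hz : z ∈ Subring.center (WW F)) (i j : ℕ) (h : ¬ (l ∣ i ∧ l ∣ j)) :
    cf z i j = 0 := by
  rw [Subring.mem_center_iff] at hz
  by_cases hi : l ∣ i
  · have hj : ¬ l ∣ j := fun hj => h ⟨hi, hj⟩
    obtain ⟨j, rfl⟩ : ∃ j', j = j' + 1 := ⟨j - 1, by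
      have : j ≠ 0 := by rintro rfl; simp at hj
      omega⟩
    have := cf_comm_x z i j
    rw [hz, sub_self, cf_zero, eq_comm, mul_eq_zero] at this
    rcases this with h0 | h0
    · exfalso; apply hj; rw [← CharP.cast_eq_zero_iff F l]; push_cast; exact h0
    · exact h0
  · obtain ⟨i, rfl⟩ : ∃ j', i = j' + 1 := ⟨i - 1, by
      have : i ≠ 0 := by rintro rfl; simp at hi
      omega⟩
    have := cf_comm_y z i j
    rw [hz, sub_self, cf_zero, eq_comm, mul_eq_zero] at this
    rcases this with h0 | h0
    · exfalso; apply hi; rw [← CharP.cast_eq_zero_iff F l]; push_cast; exact h0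
    · exact h0

end Central
end

noncomputable section
open Polynomial

section Repr
variable {R : Type} [CommRing R]

theorem cf_sum {ι : Type} (s : Finset ι) (f : ι → WW R) (i j : ℕ) :
    cf (∑ u ∈ s, f u) i j = ∑ u ∈ s, cf (f u) i j := by
  classical
  induction s using Finset.induction_on with
  | empty => simp [cf_zero]
  | insert a s ha ih => rw [Finset.sum_insert ha, Finset.sum_insert ha, cf_add, ih]

theorem weyl_repr (w : WW R) (s : Finset (ℕ × ℕ)) (h : ∀ i j, (i, j) ∉ s → cf w i j = 0) :
    w = ∑ u ∈ s, cf w u.1 u.2 • (wx R ^ u.1 * wy R ^ u.2) := by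
  apply cf_ext
  intro i j
  rw [cf_sum]
  simp only [cf_smul, cf_xy, mul_ite, mul_one, mul_zero]
  have : ∀ u ∈ s, (if u.1 = i ∧ u.2 = j then cf w u.1 u.2 else 0) =
      if u = (i, j) then cf w i j else 0 := by
    rintro ⟨a, b⟩ _
    simp only [Prod.mk.injEq]
    split_ifs with hh
    · rw [hh.1, hh.2]
    · rfl
  rw [Finset.sum_congr rfl this, Finset.sum_ite_eq' s (i, j)]
  split_ifs with hh
  · rfl
  · exact h i j hh

theorem cf_bound (w : WW R) : ∃ d : ℕ, ∀ i j, cf w i j ≠ 0 → i < d ∧ j < d := by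
  induction w using weyl_mon_induction with
  | ha a b h1 h2 =>
    obtain ⟨d, hd⟩ := h1
    obtain ⟨e, he⟩ := h2
    refine ⟨d + e, fun i j h => ?_⟩
    rw [cf_add] at h
    by_cases h0 : cf a i j = 0
    · have := he i j (by intro h1; rw [h0, h1, add_zero] at h; exact h rfl)
      omega
    · have := hd i j h0
      omega
  | hm r a b =>
    refine ⟨a + b + 1, fun i j h => ?_⟩
    rw [cf_smul, cf_xy] at h
    split_ifs at h with hh
    · omega
    · simp at h

end Repr

section Jac

theorem xyh_comm {A : Type} [Ring A] {x y h : A} (hxy : y * x = x * y + h) (hc : ∀ w, w * h = h * w) (k : ℕ) :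
    x * (y * x ^ k) = x ^ (k + 1) * y + k * h * x ^ k := by
  induction k with
  | zero => simp
  | succ k ih =>
    have : x * (y * x ^ (k + 1)) = (x * (y * x ^ k)) * x := by
      rw [pow_succ]; simp only [mul_assoc]
    rw [this, ih, add_mul, mul_assoc _ y x, hxy, mul_add, ← mul_assoc, ← pow_succ, hc,
      mul_assoc _ (x ^ k) x, ← pow_succ]
    push_cast
    rw [add_mul, add_mul, one_mul]
    abel

theorem xyh_comm2 {A : Type} [Ring A] {x y h : A} (hxy : y * x = x * y + h) (hc : ∀ w, w * h = h * w)
    (hh : h * h = 0) (j k : ℕ) :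
    x * (y ^ j * x ^ k) * y = x ^ (k + 1) * y ^ (j + 1) + (j * k : ℕ) * h * (x ^ k * y ^ j) := by
  have hcp : ∀ w, h * w = w * h := fun w => (hc w).symm
  induction j with
  | zero => simp [pow_succ, mul_assoc]; rw [← mul_assoc, ← pow_succ', pow_succ, mul_assoc]
  | succ j ih =>
    -- y commutes with x up to h
    have e1 : ∀ v : A, h * (y * x * v) = h * (x * y * v) := by
      intro v
      rw [hxy, add_mul, mul_add, ← mul_assoc h h, hh, zero_mul, add_zero]
    have e2 : ∀ n : ℕ, h * (y * x ^ n) = h * (x ^ n * y) := by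
      intro n
      induction n with
      | zero => simp
      | succ n ihn =>
        rw [pow_succ, ← mul_assoc y, ← mul_assoc h, ihn, mul_assoc h, mul_assoc (x ^ n), hxy, mul_add,
          mul_add, hc (x ^ n), ← mul_assoc h h, hh, zero_mul, add_zero, mul_assoc]
    have h1 : x * (y ^ (j + 1) * x ^ k) * y = y * (x * (y ^ j * x ^ k) * y) - h * (y ^ j * x ^ k) * y := by
      have hxy' : x * y = y * x - h := by rw [hxy]; abel
      rw [pow_succ']
      calc x * (y * y ^ j * x ^ k) * y = (x * y) * (y ^ j * x ^ k) * y := by simp only [mul_assoc]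
        _ = _ := by rw [hxy', sub_mul, sub_mul]; simp only [mul_assoc]
    have e3 : ∀ n : ℕ, h * (y ^ n * x ^ k) = h * (x ^ k * y ^ n) := by
      intro n
      induction n with
      | zero => simp
      | succ n ihn =>
        rw [pow_succ', mul_assoc, ← mul_assoc h, hcp y, mul_assoc, ihn, ← mul_assoc, ← hcp y, mul_assoc,
          ← mul_assoc y, ← mul_assoc h, e2]
        simp only [mul_assoc]
    have e4 : y * x ^ (k + 1) = x ^ (k + 1) * y + (k + 1 : ℕ) * h * x ^ k := by
      rw [pow_succ' x k, ← mul_assoc, hxy, add_mul, mul_assoc, xyh_comm hxy hc, pow_succ' x k]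
      push_cast; simp only [add_mul, one_mul]; abel
    rw [h1, ih, mul_add, ← mul_assoc y, e4, e3]
    have e5 : y * ((j * k : ℕ) * h * (x ^ k * y ^ j)) = (j * k : ℕ) * (h * (x ^ k * y ^ (j + 1))) := by
      rw [mul_assoc ((j * k : ℕ) : A), ← mul_assoc y, ← (Nat.cast_commute (j*k) y).eq, mul_assoc _ y, ← mul_assoc y h, ← hcp y,
        mul_assoc h, ← mul_assoc y, ← mul_assoc h, e2, pow_succ]
      rw [pow_succ' y j |>.symm.trans (pow_succ y j) |>.symm]
      simp only [mul_assoc, pow_succ']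
    rw [e5, add_mul, mul_assoc (x ^ (k+1)), ← pow_succ' y (j+1)]
    have e6 : ((k + 1 : ℕ) : A) * h * x ^ k * y ^ (j + 1) = (k + 1 : ℕ) * (h * (x ^ k * y ^ (j + 1))) := by
      simp only [mul_assoc]
    have e7 : h * (x ^ k * y ^ j) * y = h * (x ^ k * y ^ (j + 1)) := by
      rw [pow_succ]; simp only [mul_assoc]
    rw [e6, e7, mul_assoc (((j+1)*k : ℕ) : A)]
    generalize h * (x ^ k * y ^ (j + 1)) = t
    push_cast
    simp only [add_mul, one_mul]
    abel

theorem xyh_bracket {A : Type} [Ring A] {x y h : A} (hxy : y * x = x * y + h) (hc : ∀ w, w * h = h * w)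
    (hh : h * h = 0) (i j k m : ℕ) :
    x * ((x ^ i * y ^ j) * (x ^ k * y ^ m)) * y = x ^ (i + k + 1) * y ^ (j + m + 1) +
      (j * k : ℕ) * h * (x ^ (i + k) * y ^ (j + m)) := by
  have : x * ((x ^ i * y ^ j) * (x ^ k * y ^ m)) * y = x ^ i * (x * (y ^ j * x ^ k) * y) * y ^ m := by
    have h1 : x * x ^ i = x ^ i * x := by rw [← pow_succ, ← pow_succ']
    have h2 : y ^ m * y = y * y ^ m := by rw [← pow_succ, ← pow_succ']
    calc x * ((x ^ i * y ^ j) * (x ^ k * y ^ m)) * y = (x * x ^ i) * (y ^ j * x ^ k) * (y ^ m * y) := by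
          simp only [mul_assoc]
      _ = _ := by rw [h1, h2]; simp only [mul_assoc]
  rw [this, xyh_comm2 hxy hc hh, mul_add, add_mul]
  congr 1
  · rw [← mul_assoc, ← pow_add, mul_assoc, ← pow_add]
    congr 2 <;> ring
  · have hcm : x ^ i * ((j * k : ℕ) * h) = (j * k : ℕ) * h * x ^ i := by
      rw [← mul_assoc, ← (Nat.cast_commute (j*k) (x^i)).eq, mul_assoc, hc, mul_assoc]
    rw [← mul_assoc, hcm, mul_assoc _ (x ^ i), ← mul_assoc (x ^ i), ← pow_add, mul_assoc _ _ (y ^ m),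
      mul_assoc _ (y ^ j), ← pow_add]

variable {R F : Type} [CommRing R] [Field F] (π : R →+* F) (l : ℕ) [hl : Fact l.Prime] [CharP F l]

theorem weylMap_ker {w : WW R} (hk : ∀ r, π r = 0 → ∃ t, r = l * t) (hw : weylMap π w = 0) :
    ∃ U, w = (l : R) • U := by
  have h : ∀ i j, ∃ t, cf w i j = l * t := by
    intro i j
    apply hk
    rw [← cf_weylMap, hw, cf_zero]
  choose t ht using h
  obtain ⟨d, hd⟩ := cf_bound w
  refine ⟨∑ u ∈ Finset.range d ×ˢ Finset.range d, t u.1 u.2 • (wx R ^ u.1 * wy R ^ u.2), ?_⟩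
  rw [Finset.smul_sum]
  conv_lhs => rw [weyl_repr w (Finset.range d ×ˢ Finset.range d) (by
    intro i j hij
    by_contra h0
    apply hij
    simpa using hd i j h0)]
  refine Finset.sum_congr rfl fun u _ => ?_
  rw [smul_smul, ← ht]

theorem l_smul_eq_zero {w : WW R} (hk : ∀ r, π r = 0 → (l : R) * r = 0) (hw : weylMap π w = 0) :
    (l : R) • w = 0 := by
  apply cf_ext
  intro i j
  rw [cf_smul, cf_zero]
  apply hk
  rw [← cf_weylMap, hw, cf_zero]

theorem comm_eq {Q Q' P P' : WW R} (hk : ∀ r, π r = 0 → ∃ t, r = l * t)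
    (hk' : ∀ r, π r = 0 → (l : R) * r = 0)
    (hQ : weylMap π Q = weylMap π Q') (hP : weylMap π P = weylMap π P')
    (hQc : weylMap π Q ∈ Subring.center (WW F)) (hPc : weylMap π P ∈ Subring.center (WW F)) :
    Q * P - P * Q = Q' * P' - P' * Q' := by
  obtain ⟨U, hU⟩ := weylMap_ker π l hk (w := Q - Q') (by rw [map_sub, hQ, sub_self])
  obtain ⟨V, hV⟩ := weylMap_ker π l hk (w := P - P') (by rw [map_sub, hP, sub_self])
  have e : Q * P - P * Q - (Q' * P' - P' * Q') =
      ((Q - Q') * P - P * (Q - Q')) + (Q' * (P - P') - (P - P') * Q') := by noncomm_ring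
  rw [← sub_eq_zero, e, hU, hV, smul_mul_assoc, mul_smul_comm, smul_mul_assoc, mul_smul_comm,
    ← smul_sub, ← smul_sub, l_smul_eq_zero π l hk', l_smul_eq_zero π l hk', add_zero]
  · rw [map_sub, map_mul, map_mul, ← hQ, Subring.mem_center_iff.1 hQc, sub_self]
  · rw [map_sub, map_mul, map_mul, Subring.mem_center_iff.1 hPc, sub_self]

theorem jac_main (hk : ∀ r, π r = 0 → ∃ t, r = l * t)
    (hk' : ∀ r, π r = 0 ↔ (l : R) * r = 0) (h0 : (l : R) ^ 2 = 0)
    {Q P : WW R} (hQc : weylMap π Q ∈ Subring.center (WW F)) (hPc : weylMap π P ∈ Subring.center (WW F))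
    (hQP : Q * P = P * Q + algebraMap R _ (l.factorial : R)) (s : Finset (ℕ × ℕ))
    (hQs : ∀ i j, (i, j) ∉ s → cf (weylMap π Q) (l * i) (l * j) = 0)
    (hPs : ∀ i j, (i, j) ∉ s → cf (weylMap π P) (l * i) (l * j) = 0) (a b : ℕ) :
    ∑ u ∈ s, ∑ v ∈ s, (if u.1 + v.1 = a ∧ u.2 + v.2 = b then
      cf (weylMap π Q) (l * u.1) (l * u.2) * cf (weylMap π P) (l * v.1) (l * v.2) *
        ((u.2 : F) * v.1 - u.1 * v.2) else 0) = if a = 1 ∧ b = 1 then 1 else 0 := by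
  classical
  have hlp := hl.out.pos
  set x := wx R ^ l with hx
  set y := wy R ^ l with hy
  set h : WW R := algebraMap R _ (l.factorial : R) with hh
  have hxy : y * x = x * y + h := ypow_xpow_sq l hl.out h0
  have hc : ∀ w, w * h = h * w := fun w => (Algebra.commutes _ w).symm
  obtain ⟨l', hl'⟩ : ∃ l', l = l' + 1 := ⟨l - 1, by omega⟩
  have hfac : (l.factorial : R) = l * (l'.factorial : R) := by
    rw [hl', Nat.factorial_succ]; push_cast; ring
  have hunit : (l'.factorial : F) ≠ 0 := by
    rw [Ne, CharP.cast_eq_zero_iff F l, Nat.Prime.dvd_factorial hl.out]; omega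
  have hhh : h * h = 0 := by
    rw [hh, ← map_mul, hfac]
    have : (l : R) * l'.factorial * (l * l'.factorial) = l ^ 2 * l'.factorial ^ 2 := by ring
    rw [this, h0, zero_mul, map_zero]
  -- the lifts
  have lift : ∀ (Q : WW R), weylMap π Q ∈ Subring.center (WW F) →
      (∀ i j, (i, j) ∉ s → cf (weylMap π Q) (l * i) (l * j) = 0) →
      weylMap π Q = weylMap π (∑ u ∈ s, cf Q (l * u.1) (l * u.2) • (x ^ u.1 * y ^ u.2)) := by
    intro Q hQc hQs
    have hinj : Set.InjOn (fun u : ℕ × ℕ => (l * u.1, l * u.2)) s := by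
      rintro ⟨a, b⟩ _ ⟨c, d⟩ _ hab
      simp only [Prod.mk.injEq] at hab
      rw [Nat.eq_of_mul_eq_mul_left hlp hab.1, Nat.eq_of_mul_eq_mul_left hlp hab.2]
    rw [weyl_repr (weylMap π Q) (s.image fun u => (l * u.1, l * u.2)) ?_, map_sum,
      Finset.sum_image hinj]
    · refine Finset.sum_congr rfl fun u _ => ?_
      rw [weylMap_smul, hx, hy]
      simp only [map_mul, map_pow, weylMap_x, weylMap_y]
      rw [cf_weylMap, ← pow_mul, ← pow_mul]
    · intro i j hij
      by_cases hd : l ∣ i ∧ l ∣ j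
      · obtain ⟨⟨i, rfl⟩, ⟨j, rfl⟩⟩ := hd
        apply hQs
        intro hm
        exact hij (Finset.mem_image.2 ⟨(i, j), hm, rfl⟩)
      · exact cf_central l hQc _ _ hd
  have hE := comm_eq π l hk (fun r => (hk' r).1) (lift Q hQc hQs) (lift P hPc hPs) hQc hPc
  set q : ℕ × ℕ → R := fun u => cf Q (l * u.1) (l * u.2) with hq
  set p : ℕ × ℕ → R := fun u => cf P (l * u.1) (l * u.2) with hp
  have hE2 : x * (Q * P - P * Q) * y = h * ∑ u ∈ s, ∑ v ∈ s, (q u * p v * ((u.2 : R) * v.1 - u.1 * v.2)) •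
      (x ^ (u.1 + v.1) * y ^ (u.2 + v.2)) := by
    have hE' := hE
    change _ = (∑ u ∈ s, q u • (x ^ u.1 * y ^ u.2)) * (∑ u ∈ s, p u • (x ^ u.1 * y ^ u.2)) -
      (∑ u ∈ s, p u • (x ^ u.1 * y ^ u.2)) * (∑ u ∈ s, q u • (x ^ u.1 * y ^ u.2)) at hE'
    rw [hE']
    have d1 : ∀ (f g : ℕ × ℕ → R), x * ((∑ u ∈ s, f u • (x ^ u.1 * y ^ u.2)) *
        (∑ u ∈ s, g u • (x ^ u.1 * y ^ u.2))) * y = ∑ u ∈ s, ∑ v ∈ s, (f u * g v) •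
        (x * ((x ^ u.1 * y ^ u.2) * (x ^ v.1 * y ^ v.2)) * y) := by
      intro f g
      rw [Finset.sum_mul_sum, Finset.mul_sum, Finset.sum_mul]
      refine Finset.sum_congr rfl fun u _ => ?_
      rw [Finset.mul_sum, Finset.sum_mul]
      refine Finset.sum_congr rfl fun v _ => ?_
      rw [smul_mul_smul_comm, mul_smul_comm, smul_mul_assoc]
    rw [mul_sub, sub_mul, d1, d1, Finset.sum_comm (s := s) (t := s) (f := fun u v => (p u * q v) • _),
      ← Finset.sum_sub_distrib, Finset.mul_sum]
    refine Finset.sum_congr rfl fun u _ => ?_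
    rw [← Finset.sum_sub_distrib, Finset.mul_sum]
    refine Finset.sum_congr rfl fun v _ => ?_
    rw [mul_comm (p v), ← smul_sub, xyh_bracket hxy hc hhh, xyh_bracket hxy hc hhh, mul_smul_comm, mul_smul (q u * p v)]
    congr 1
    rw [add_comm v.1 u.1, add_comm v.2 u.2, add_sub_add_left_eq_sub, ← sub_mul, ← sub_mul,
      Algebra.smul_def, mul_assoc]
    congr 1
    push_cast
    rw [(Nat.cast_commute v.2 (u.1 : WW R)).eq]
  have hE3 : h * ((∑ u ∈ s, ∑ v ∈ s, (q u * p v * ((u.2 : R) * v.1 - u.1 * v.2)) •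
      (x ^ (u.1 + v.1) * y ^ (u.2 + v.2))) - x * y) = 0 := by
    rw [mul_sub, ← hE2, hQP, add_sub_cancel_left, hc, mul_assoc, sub_self]
  set T := ((∑ u ∈ s, ∑ v ∈ s, (q u * p v * ((u.2 : R) * v.1 - u.1 * v.2)) •
      (x ^ (u.1 + v.1) * y ^ (u.2 + v.2))) - x * y) with hT
  have hE4 : cf (weylMap π T) (l * a) (l * b) = 0 := by
    have h1 : cf (h * T) (l * a) (l * b) = 0 := by rw [hE3, cf_zero]
    rw [hh, ← Algebra.smul_def, cf_smul, hfac, mul_assoc, ← hk', map_mul, map_natCast] at h1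
    rw [cf_weylMap]
    exact (mul_eq_zero.1 h1).resolve_left hunit
  have hinj : ∀ m n : ℕ, l * m = l * n ↔ m = n :=
    fun m n => ⟨fun h => Nat.eq_of_mul_eq_mul_left hlp h, fun h => by rw [h]⟩
  rw [cf_weylMap, hT, cf_sub, map_sub, sub_eq_zero, cf_sum, map_sum] at hE4
  have hxy1 : cf (x * y) (l * a) (l * b) = if a = 1 ∧ b = 1 then 1 else 0 := by
    rw [hx, hy, cf_xy]
    have e1 : l = l * a ↔ a = 1 := by
      conv_lhs => lhs; rw [← mul_one l]
      rw [hinj, eq_comm]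
    have e2 : l = l * b ↔ b = 1 := by
      conv_lhs => lhs; rw [← mul_one l]
      rw [hinj, eq_comm]
    simp only [e1, e2]
  rw [hxy1] at hE4
  have hr : π (if a = 1 ∧ b = 1 then 1 else 0) = if a = 1 ∧ b = 1 then 1 else 0 := by
    split_ifs <;> simp
  rw [← hr, ← hE4]
  refine Finset.sum_congr rfl fun u _ => ?_
  rw [cf_sum, map_sum]
  refine Finset.sum_congr rfl fun v _ => ?_
  rw [cf_smul, hx, hy, ← pow_mul, ← pow_mul, cf_xy]
  simp only [hinj, cf_weylMap]
  split_ifs <;> simp [hq, hp]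

end Jac
end

noncomputable section

section Comb
variable {F : Type} [Field F] (l : ℕ) [CharP F l]

theorem coef_single (s : Finset (ℕ × ℕ)) (q p : ℕ × ℕ → F)
    (hN : ∀ a b, ∑ u ∈ s, ∑ v ∈ s, (if u.1 + v.1 = a ∧ u.2 + v.2 = b then
      q u * p v * ((u.2 : F) * v.1 - u.1 * v.2) else 0) = if a = 1 ∧ b = 1 then 1 else 0)
    (u₀ v₀ : ℕ × ℕ) (hu : u₀ ∈ s) (hv : v₀ ∈ s)
    (huniq : ∀ u ∈ s, ∀ v ∈ s, q u ≠ 0 → p v ≠ 0 → ((u.2 : F) * v.1 - u.1 * v.2) ≠ 0 →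
      u.1 + v.1 = u₀.1 + v₀.1 → u.2 + v.2 = u₀.2 + v₀.2 → u = u₀ ∧ v = v₀)
    (hne : q u₀ * p v₀ * ((u₀.2 : F) * v₀.1 - u₀.1 * v₀.2) ≠ 0) :
    u₀.1 + v₀.1 = 1 ∧ u₀.2 + v₀.2 = 1 := by
  have h := hN (u₀.1 + v₀.1) (u₀.2 + v₀.2)
  rw [Finset.sum_eq_single u₀, Finset.sum_eq_single v₀] at h
  · by_contra hc
    rw [if_neg hc] at h
    simp only [and_self, if_true] at h
    exact hne h
  · intro v hv' hvne
    split_ifs with hh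
    · by_contra h0
      have h1 := mul_ne_zero_iff.1 h0
      have h2 := mul_ne_zero_iff.1 h1.1
      exact hvne (huniq u₀ hu v hv' h2.1 h2.2 h1.2 hh.1 hh.2).2
    · rfl
  · intro h; exact absurd hv h
  · intro u hu' hune
    refine Finset.sum_eq_zero fun v hv' => ?_
    split_ifs with hh
    · by_contra h0
      have h1 := mul_ne_zero_iff.1 h0
      have h2 := mul_ne_zero_iff.1 h1.1
      exact hune (huniq u hu' v hv' h2.1 h2.2 h1.2 hh.1 hh.2).1
    · rfl
  · intro h; exact absurd hu h

theorem comb_main (d : ℕ) (hd : d * d ≤ l) (q p : ℕ × ℕ → F)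
    (hqs : ∀ u, q u ≠ 0 → u.1 < d ∧ u.2 < d) (hps : ∀ u, p u ≠ 0 → u.1 < d ∧ u.2 < d)
    (hqo : ∀ u, q u ≠ 0 → Odd u.2) (hpe : ∀ u, p u ≠ 0 → Even u.2)
    (hN : ∀ a b, ∑ u ∈ Finset.range d ×ˢ Finset.range d, ∑ v ∈ Finset.range d ×ˢ Finset.range d,
      (if u.1 + v.1 = a ∧ u.2 + v.2 = b then
      q u * p v * ((u.2 : F) * v.1 - u.1 * v.2) else 0) = if a = 1 ∧ b = 1 then 1 else 0) :
    ∀ u, q u ≠ 0 → u.1 = 0 := by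
  classical
  set s := Finset.range d ×ˢ Finset.range d with hs
  have hmem : ∀ u, u ∈ s ↔ u.1 < d ∧ u.2 < d := fun u => by simp [hs]
  have hdet : ∀ u ∈ s, ∀ v ∈ s, u.1 * v.2 < u.2 * v.1 → ((u.2 : F) * v.1 - u.1 * v.2) ≠ 0 := by
    intro u hu v hv hlt h0
    rw [hmem] at hu hv
    have e : ((u.2 * v.1 - u.1 * v.2 : ℕ) : F) = 0 := by
      rw [Nat.cast_sub hlt.le]; push_cast; exact h0
    rw [CharP.cast_eq_zero_iff F l] at e
    have := Nat.le_of_dvd (by omega) e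
    have : u.2 * v.1 < d * d := Nat.mul_lt_mul'' hu.2 hv.1
    omega
  -- step 1
  have h01 : q (0, 1) ≠ 0 ∧ p (1, 0) ≠ 0 := by
    have h := hN 1 1
    simp only [and_self, if_true] at h
    have h1 : ∑ u ∈ s, ∑ v ∈ s, (if u.1 + v.1 = 1 ∧ u.2 + v.2 = 1 then
      q u * p v * ((u.2 : F) * v.1 - u.1 * v.2) else 0) ≠ 0 := by rw [h]; exact one_ne_zero
    obtain ⟨u, hu, h2⟩ := Finset.exists_ne_zero_of_sum_ne_zero h1
    obtain ⟨v, hv, h3⟩ := Finset.exists_ne_zero_of_sum_ne_zero h2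
    split_ifs at h3 with hh
    · have h4 := mul_ne_zero_iff.1 h3
      have h5 := mul_ne_zero_iff.1 h4.1
      obtain ⟨n, hn⟩ := hqo u h5.1
      have hu2 : u.2 = 1 := by omega
      have hv2 : v.2 = 0 := by omega
      have hv1 : v.1 ≠ 0 := by
        intro h0
        apply h4.2
        rw [h0, hv2]; simp
      have e1 : u = (0, 1) := Prod.ext (by simp; omega) hu2
      have e2 : v = (1, 0) := Prod.ext (by simp; omega) hv2
      rw [← e1, ← e2]; exact h5
    · exact absurd rfl h3
  have h1 : (∀ i, q (i, 1) ≠ 0 → i = 0) ∧ (∀ k, p (k, 0) ≠ 0 → k ≤ 1) := by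
    obtain ⟨u₀, hu₀, hum⟩ := Finset.exists_max_image (s.filter fun u => q u ≠ 0 ∧ u.2 = 1) (fun u => u.1)
      ⟨(0, 1), Finset.mem_filter.2 ⟨(hmem _).2 (hqs _ h01.1), h01.1, rfl⟩⟩
    obtain ⟨v₀, hv₀, hvm⟩ := Finset.exists_max_image
      (s.filter fun u => p u ≠ 0 ∧ u.2 = 0 ∧ 1 ≤ u.1) (fun u => u.1)
      ⟨(1, 0), Finset.mem_filter.2 ⟨(hmem _).2 (hps _ h01.2), h01.2, rfl, le_rfl⟩⟩
    simp only [Finset.mem_filter] at hu₀ hv₀ hum hvm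
    obtain ⟨hus, huq, hu2⟩ := hu₀
    obtain ⟨hvs, hvp, hv2, hv1⟩ := hv₀
    have := coef_single s q p hN u₀ v₀ hus hvs (by
      intro u hu v hv hqu hpv hdt e1 e2
      obtain ⟨n, hn⟩ := hqo u hqu
      have hu2' : u.2 = 1 := by omega
      have hv2' : v.2 = 0 := by omega
      have hv1' : v.1 ≠ 0 := by
        intro h0
        apply hdt
        rw [h0, hv2']; simp
      have k1 := hum u ⟨hu, hqu, hu2'⟩
      have k2 := hvm v ⟨hv, hpv, hv2', by omega⟩
      exact ⟨Prod.ext (by omega) (by omega), Prod.ext (by omega) (by omega)⟩) (by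
      refine mul_ne_zero (mul_ne_zero huq hvp) (hdet _ hus _ hvs ?_)
      rw [hu2, hv2]; omega)
    refine ⟨fun i hi => ?_, fun k hk => ?_⟩
    · have := hum (i, 1) ⟨(hmem _).2 (hqs _ hi), hi, rfl⟩
      simp only at this
      omega
    · by_contra hk1
      have := hvm (k, 0) ⟨(hmem _).2 (hps _ hk), hk, rfl, by simp; omega⟩
      simp only at this
      omega
  -- step 2
  by_contra hcon
  push Not at hcon
  obtain ⟨w, hw, hw1⟩ := hcon
  set T : Finset (ℕ × ℕ) := ((s.filter fun u => q u ≠ 0 ∧ 0 < u.1).image fun u => (u.1, u.2 - 1)) ∪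
    ((s.filter fun u => p u ≠ 0 ∧ 2 ≤ u.1).image fun u => (u.1 - 1, u.2)) with hT
  have hTq : ∀ u, q u ≠ 0 → 0 < u.1 → (u.1, u.2 - 1) ∈ T := by
    intro u h1 h2
    rw [hT, Finset.mem_union]; left
    exact Finset.mem_image.2 ⟨u, Finset.mem_filter.2 ⟨(hmem u).2 (hqs u h1), h1, h2⟩, rfl⟩
  have hTp : ∀ u, p u ≠ 0 → 2 ≤ u.1 → (u.1 - 1, u.2) ∈ T := by
    intro u h1 h2
    rw [hT, Finset.mem_union]; right
    exact Finset.mem_image.2 ⟨u, Finset.mem_filter.2 ⟨(hmem u).2 (hps u h1), h1, h2⟩, rfl⟩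
  have hq2 : ∀ u, q u ≠ 0 → 0 < u.1 → 2 ≤ u.2 := by
    intro u hu hu1
    obtain ⟨n, hn⟩ := hqo u hu
    by_contra hc
    have e : u.2 = 1 := by omega
    have := h1.1 u.1 (by rw [← e]; exact hu)
    omega
  have hp2 : ∀ u, p u ≠ 0 → 2 ≤ u.1 → 1 ≤ u.2 := by
    intro u hu hu1
    by_contra hc
    have e : u.2 = 0 := by omega
    have := h1.2 u.1 (by rw [← e]; exact hu)
    omega
  have hTpos : ∀ t ∈ T, 0 < t.1 ∧ 0 < t.2 := by
    intro t ht
    rw [hT, Finset.mem_union, Finset.mem_image, Finset.mem_image] at ht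
    rcases ht with ⟨u, hu, rfl⟩ | ⟨u, hu, rfl⟩
    · rw [Finset.mem_filter] at hu
      have := hq2 u hu.2.1 hu.2.2
      simp only; omega
    · rw [Finset.mem_filter] at hu
      have := hp2 u hu.2.1 hu.2.2
      simp only; omega
  obtain ⟨t, ht, htm⟩ := Finset.exists_max_image T (fun t => (t.1 : ℚ) / t.2) ⟨_, hTq w hw (by omega)⟩
  set r : ℚ := (t.1 : ℚ) / t.2 with hr
  have ht12 := hTpos t ht
  have ht2 : (0 : ℚ) < t.2 := by exact_mod_cast ht12.2
  have hr0 : 0 < r := by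
    have : (0 : ℚ) < t.1 := by exact_mod_cast ht12.1
    positivity
  have hTr : ∀ t' ∈ T, (t'.1 : ℚ) ≤ r * t'.2 := by
    intro t' ht'
    have h2 := (hTpos t' ht').2
    have h3 : (0 : ℚ) < t'.2 := by exact_mod_cast h2
    exact (div_le_iff₀ h3).1 (htm t' ht')
  have htr : (t.1 : ℚ) = r * t.2 := by rw [hr]; field_simp
  have hQle : ∀ u, q u ≠ 0 → (u.1 : ℚ) ≤ r * (u.2 - 1) := by
    intro u hu
    obtain ⟨n, hn⟩ := hqo u hu
    rcases Nat.eq_zero_or_pos u.1 with h0 | h0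
    · rw [h0, hn]; push_cast
      have : (0 : ℚ) ≤ n := by positivity
      nlinarith
    · have := hTr _ (hTq u hu h0)
      simp only at this
      rw [Nat.cast_sub (by omega)] at this
      exact_mod_cast this
  have hPle : ∀ u, p u ≠ 0 → (u.1 : ℚ) - 1 ≤ r * u.2 := by
    intro u hu
    by_cases h0 : 2 ≤ u.1
    · have := hTr _ (hTp u hu h0)
      simp only at this
      rw [Nat.cast_sub (by omega)] at this
      exact_mod_cast this
    · have h3 : (u.1 : ℚ) ≤ 1 := by exact_mod_cast (by omega : u.1 ≤ 1)
      have : (0 : ℚ) ≤ u.2 := by positivity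
      nlinarith
  obtain ⟨u₀, hu₀, hum⟩ := Finset.exists_max_image
    (s.filter fun u => q u ≠ 0 ∧ (u.1 : ℚ) = r * (u.2 - 1)) (fun u => u.2)
    ⟨(0, 1), by simp only [Finset.mem_filter, hmem]; exact ⟨hqs _ h01.1, h01.1, by simp⟩⟩
  obtain ⟨v₀, hv₀, hvm⟩ := Finset.exists_max_image
    (s.filter fun u => p u ≠ 0 ∧ (u.1 : ℚ) - 1 = r * u.2) (fun u => u.2)
    ⟨(1, 0), by simp only [Finset.mem_filter, hmem]; exact ⟨hps _ h01.2, h01.2, by simp⟩⟩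
  simp only [Finset.mem_filter] at hu₀ hv₀ hum hvm
  obtain ⟨hus, huq, hu2⟩ := hu₀
  obtain ⟨hvs, hvp, hv2⟩ := hv₀
  have hfin := coef_single s q p hN u₀ v₀ hus hvs (by
    intro u hu v hv hqu hpv hdt e1 e2
    have e1' : (u.1 : ℚ) + v.1 = u₀.1 + v₀.1 := by exact_mod_cast e1
    have e2' : (u.2 : ℚ) + v.2 = u₀.2 + v₀.2 := by exact_mod_cast e2
    have k1 := hQle u hqu
    have k2 := hPle v hpv
    have e3 : r * (u.2 : ℚ) + r * v.2 = r * u₀.2 + r * v₀.2 := by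
      rw [← mul_add, e2', mul_add]
    have k3 : (u.1 : ℚ) = r * (u.2 - 1) := by linarith
    have k4 : (v.1 : ℚ) - 1 = r * v.2 := by linarith
    have k5 := hum u ⟨hu, hqu, k3⟩
    have k6 := hvm v ⟨hv, hpv, k4⟩
    have k7 : u.2 = u₀.2 := by omega
    have k8 : v.2 = v₀.2 := by omega
    have k9 : u.1 = u₀.1 := by
      have : (u.1 : ℚ) = u₀.1 := by rw [k3, hu2, k7]
      exact_mod_cast this
    exact ⟨Prod.ext k9 k7, Prod.ext (by omega) k8⟩) (by
    refine mul_ne_zero (mul_ne_zero huq hvp) (hdet _ hus _ hvs ?_)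
    have hv1 : (v₀.1 : ℚ) = 1 + r * v₀.2 := by linarith
    have : (u₀.1 : ℚ) * v₀.2 < u₀.2 * v₀.1 := by
      rw [hu2, hv1]
      obtain ⟨n, hn⟩ := hqo u₀ huq
      have h3 : (0 : ℚ) < u₀.2 := by exact_mod_cast (by omega : 0 < u₀.2)
      have h4 : (0 : ℚ) ≤ r * v₀.2 := by positivity
      nlinarith
    exact_mod_cast this)
  have hodd := hqo u₀ huq
  obtain ⟨n, hn⟩ := hodd
  rw [hT, Finset.mem_union, Finset.mem_image, Finset.mem_image] at ht
  rcases ht with ⟨u, hu, rfl⟩ | ⟨u, hu, rfl⟩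
  · rw [Finset.mem_filter] at hu
    have h3 := hq2 u hu.2.1 hu.2.2
    have h4 := hum u ⟨hu.1, hu.2.1, by
      simp only at htr
      rw [Nat.cast_sub (by omega)] at htr
      exact_mod_cast htr⟩
    omega
  · rw [Finset.mem_filter] at hu
    have h3 := hp2 u hu.2.1 hu.2.2
    have h4 := hvm u ⟨hu.1, hu.2.1, by
      simp only at htr
      rw [Nat.cast_sub (by omega)] at htr
      exact_mod_cast htr⟩
    omega

end Comb
end

noncomputable section
open Polynomial

section ModL

theorem cf_repr {R : Type} [CommRing R] (s : Finset (ℕ × ℕ)) (c : ℕ × ℕ → R) (i j : ℕ) :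
    cf (∑ u ∈ s, c u • (wx R ^ u.1 * wy R ^ u.2)) i j = if (i, j) ∈ s then c (i, j) else 0 := by
  classical
  rw [cf_sum]
  simp only [cf_smul, cf_xy, mul_ite, mul_one, mul_zero]
  have : ∀ u ∈ s, (if u.1 = i ∧ u.2 = j then c u else 0) =
      if u = (i, j) then c (i, j) else 0 := by
    rintro ⟨a, b⟩ _
    simp only [Prod.mk.injEq]
    split_ifs with hh
    · rw [hh.1, hh.2]
    · rfl
  rw [Finset.sum_congr rfl this, Finset.sum_ite_eq' s (i, j)]

theorem beta_sum {R : Type} [CommRing R] {ι : Type} (s : Finset ι) (f : ι → WW R) :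
    beta (∑ u ∈ s, f u) = ∑ u ∈ s, beta (f u) := by
  classical
  induction s using Finset.induction_on with
  | empty => simp [beta_zero]
  | insert a s ha ih => rw [Finset.sum_insert ha, Finset.sum_insert ha, beta_add, ih]

variable {R F : Type} [CommRing R] [Field F] (π : R →+* F) (l : ℕ) [hl : Fact l.Prime] [CharP F l]

theorem cf_beta_central (l : ℕ) [hl : Fact l.Prime] [CharP F l] {z : WW F} (hz : z ∈ Subring.center (WW F)) (i j : ℕ) :
    cf (beta z) i j = (-1) ^ j * cf z i j := by
  obtain ⟨d, hd⟩ := cf_bound z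
  set s := Finset.range d ×ˢ Finset.range d with hs
  have hs' : ∀ i j, (i, j) ∉ s → cf z i j = 0 := by
    intro i j hij
    by_contra h0
    exact hij (by simpa [hs] using hd i j h0)
  have h1 := weyl_repr z s hs'
  have h2 : beta z = ∑ u ∈ s, ((-1) ^ u.2 * cf z u.1 u.2) • (wx F ^ u.1 * wy F ^ u.2) := by
    conv_lhs => rw [h1]
    rw [beta_sum]
    refine Finset.sum_congr rfl fun u _ => ?_
    rw [beta_smul]
    by_cases hl : l ∣ u.1 ∧ l ∣ u.2
    · obtain ⟨k, hk⟩ := hl.1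
      have hc := Subring.mem_center_iff.1 (Subring.pow_mem _ (xl_central (F := F) l) k) (wy F ^ u.2)
      rw [beta_mul, beta_pow, beta_pow, beta_x, beta_y, neg_pow, mul_assoc, hk, pow_mul, hc, mul_comm ((-1 : F) ^ u.2),
        mul_smul]
      congr 1
      rw [Algebra.smul_def]; simp
    · rw [cf_central l hz _ _ hl]; simp
  rw [h2, cf_repr (c := fun u => (-1) ^ u.2 * cf z u.1 u.2)]
  split_ifs with hh
  · rfl
  · rw [hs' i j hh, mul_zero]

theorem cf_pow_bound {B : WW F} (d : ℕ) (hB : ∀ i j, cf B i j ≠ 0 → i < d ∧ j < d) (i j : ℕ)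
    (h : cf (B ^ l) (l * i) (l * j) ≠ 0) : i < d ∧ j < d := by
  have hlp := hl.out.pos
  have hB0 : B ≠ 0 := by
    rintro rfl
    rw [zero_pow hlp.ne', cf_zero] at h
    exact h rfl
  have hd : 0 < d := by
    by_contra hd
    apply hB0
    apply cf_ext
    intro i j
    rw [cf_zero]
    by_contra h0
    have := hB i j h0
    omega
  have h1 : (sym F B).natDegree ≤ d - 1 := by
    rw [natDegree_le_iff_coeff_eq_zero]
    intro N hN
    ext j
    by_contra h0
    have := hB N j (by rw [coeff_zero] at h0; exact h0)
    omega
  have h2 : ydeg (d - 1) (sym F B) := by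
    intro i
    rw [natDegree_le_iff_coeff_eq_zero]
    intro N hN
    by_contra h0
    have := hB i N h0
    omega
  have h3 := (sym_pow_natDegree hB0 l).2
  have h4 := ydeg_pow h2 l
  constructor
  · have : l * i ≤ (sym F (B ^ l)).natDegree := by
      apply le_natDegree_of_ne_zero
      intro h0
      apply h
      rw [cf, h0, coeff_zero]
    rw [h3] at this
    have := Nat.le_of_mul_le_mul_left this hlp
    omega
  · have : l * j ≤ ((sym F (B ^ l)).coeff (l * i)).natDegree := le_natDegree_of_ne_zero h
    have := Nat.le_of_mul_le_mul_left (this.trans (h4 _)) hlp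
    omega

theorem modl_main (hl2 : l ≠ 2) (hk : ∀ r, π r = 0 → ∃ t, r = l * t)
    (hk' : ∀ r, π r = 0 ↔ (l : R) * r = 0) (h0 : (l : R) ^ 2 = 0)
    {A B : WW R} (hAB : B * A = A * B + 1) (hA : beta A = A) (hB : beta B = -B)
    (d : ℕ) (hd : d * d ≤ l)
    (hAd : ∀ i j, cf (weylMap π A) i j ≠ 0 → i < d ∧ j < d)
    (hBd : ∀ i j, cf (weylMap π B) i j ≠ 0 → i < d ∧ j < d) (i j : ℕ)
    (hij : cf (weylMap π B) i j ≠ 0) : i = 0 := by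
  have hlp := hl.out.pos
  have hodd : Odd l := hl.out.odd_of_ne_two hl2
  have hAB' : weylMap π B * weylMap π A = weylMap π A * weylMap π B + 1 := by
    rw [← map_mul, hAB, map_add, map_mul, map_one]
  obtain ⟨hcA, hcB⟩ := bl_central l hAB'
  have hcA' : weylMap π (A ^ l) ∈ Subring.center (WW F) := by rw [map_pow]; exact hcA
  have hcB' : weylMap π (B ^ l) ∈ Subring.center (WW F) := by rw [map_pow]; exact hcB
  have hbB : ∀ i j, cf (weylMap π (B ^ l)) i j = - ((-1) ^ j * cf (weylMap π (B ^ l)) i j) := by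
    intro i j
    rw [← cf_beta_central l hcB', ← weylMap_beta, beta_pow, hB, hodd.neg_pow, map_neg]
    have : ∀ w : WW F, cf w i j = - cf (-w) i j := by
      intro w; simp [cf]
    exact this _
  have hbA : ∀ i j, cf (weylMap π (A ^ l)) i j = (-1) ^ j * cf (weylMap π (A ^ l)) i j := by
    intro i j
    rw [← cf_beta_central l hcA', ← weylMap_beta, beta_pow, hA]
  have htwo : (2 : F) ≠ 0 := by
    have : ((2 : ℕ) : F) ≠ 0 := by
      rw [Ne, CharP.cast_eq_zero_iff F l]
      intro h
      exact hl2 ((Nat.prime_dvd_prime_iff_eq hl.out Nat.prime_two).1 h)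
    exact_mod_cast this
  have hmem : ∀ i j, (i, j) ∉ Finset.range d ×ˢ Finset.range d → ¬ (i < d ∧ j < d) := by
    intro i j h; simpa using h
  have hQs : ∀ i j, cf (weylMap π (B ^ l)) (l * i) (l * j) ≠ 0 → i < d ∧ j < d := by
    intro i j h
    rw [map_pow] at h
    exact cf_pow_bound l d hBd i j h
  have hPs : ∀ i j, cf (weylMap π (A ^ l)) (l * i) (l * j) ≠ 0 → i < d ∧ j < d := by
    intro i j h
    rw [map_pow] at h
    exact cf_pow_bound l d hAd i j h
  have key := comb_main l d hd (fun u => cf (weylMap π (B ^ l)) (l * u.1) (l * u.2))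
    (fun u => cf (weylMap π (A ^ l)) (l * u.1) (l * u.2)) (fun u => hQs _ _) (fun u => hPs _ _)
    (by
      intro u hu
      by_contra hne
      rw [Nat.not_odd_iff_even] at hne
      have := hbB (l * u.1) (l * u.2)
      rw [(hne.mul_left l).neg_one_pow, one_mul, eq_neg_iff_add_eq_zero, ← two_mul] at this
      exact hu ((mul_eq_zero.1 this).resolve_left htwo))
    (by
      intro u hu
      by_contra hne
      rw [Nat.not_even_iff_odd] at hne
      have := hbA (l * u.1) (l * u.2)
      rw [(hodd.mul hne).neg_one_pow, neg_one_mul, eq_neg_iff_add_eq_zero, ← two_mul] at this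
      exact hu ((mul_eq_zero.1 this).resolve_left htwo))
    (fun a b => jac_main π l hk hk' h0 hcB' hcA' (gen_ypow_xpow_sq l hl.out h0 hAB) _
      (fun i j h => by by_contra h1; exact hmem i j h (hQs i j h1))
      (fun i j h => by by_contra h1; exact hmem i j h (hPs i j h1)) a b)
  have hB0 : weylMap π B ≠ 0 := by
    intro h; rw [h, cf_zero] at hij; exact hij rfl
  obtain ⟨hne, hdeg⟩ := sym_pow_natDegree hB0 l
  have hne' : sym F (weylMap π B ^ l) ≠ 0 := fun h => hne (sym_inj (by simpa using h))
  have hlc : (sym F (weylMap π B ^ l)).coeff (l * (sym F (weylMap π B)).natDegree) ≠ 0 := by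
    rw [← hdeg]
    exact leadingCoeff_ne_zero.2 hne'
  obtain ⟨j', hj'⟩ : ∃ j', cf (weylMap π B ^ l) (l * (sym F (weylMap π B)).natDegree) j' ≠ 0 := by
    by_contra hc
    push Not at hc
    apply hlc
    ext j
    rw [coeff_zero]
    exact hc j
  have hdvd : l ∣ j' := by
    by_contra hc
    exact hj' (cf_central l hcB _ _ (fun h => hc h.2))
  obtain ⟨j'', rfl⟩ := hdvd
  have h1 := key ((sym F (weylMap π B)).natDegree, j'') (by
    simp only [map_pow]
    exact hj')
  simp only at h1
  have h2 : i ≤ (sym F (weylMap π B)).natDegree := by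
    apply le_natDegree_of_ne_zero
    intro h; apply hij; rw [cf, h, coeff_zero]
  omega

end ModL
end

noncomputable section
open Polynomial

section Padic7

theorem schur_prime (f : ℤ[X]) (hf : 0 < f.natDegree) (N : ℕ) :
    ∃ l : ℕ, l.Prime ∧ N < l ∧ ∃ r : ℤ, (l : ℤ) ∣ f.eval r := by
  by_cases ha : f.eval 0 = 0
  · obtain ⟨l, h1, h2⟩ := Nat.exists_infinite_primes (N + 1)
    exact ⟨l, h2, h1, 0, by rw [ha]; exact dvd_zero _⟩
  set a := f.eval 0 with hadef
  set M : ℤ := ((N.factorial : ℕ) : ℤ) with hM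
  have hM0 : M ≠ 0 := by
    rw [hM]; exact_mod_cast N.factorial_ne_zero
  set h := f.comp (C (a * M) * X) with hh
  have hdeg : 0 < h.natDegree := by
    rw [hh, natDegree_comp, natDegree_C_mul_X _ (mul_ne_zero ha hM0), mul_one]; exact hf
  have hne : ∀ c : ℤ, h - C c ≠ 0 := by
    intro c hc
    rw [sub_eq_zero] at hc
    rw [hc, natDegree_C] at hdeg
    exact lt_irrefl _ hdeg
  have hprod : h * ((h - C a) * (h - C (-a))) ≠ 0 := by
    refine mul_ne_zero ?_ (mul_ne_zero (hne _) (hne _))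
    simpa using hne 0
  obtain ⟨s, hs⟩ : ∃ s, (h * ((h - C a) * (h - C (-a)))).eval s ≠ 0 := by
    by_contra hcon
    push Not at hcon
    exact hprod (Polynomial.funext fun s => by rw [hcon s, eval_zero])
  have hev : h.eval s = f.eval (a * M * s) := by
    rw [hh, eval_comp]; simp
  obtain ⟨k, hk⟩ := sub_dvd_eval_sub (a * M * s) 0 f
  have hfe : h.eval s = a * (1 + M * s * k) := by
    rw [hev]
    rw [sub_zero, ← hadef] at hk
    linear_combination hk
  simp only [eval_mul, eval_sub, eval_C, hfe] at hs
  set t := 1 + M * s * k with ht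
  have hnat : t.natAbs ≠ 1 := by
    intro h1
    rcases Int.natAbs_eq_iff.1 h1 with h2 | h2 <;> apply hs <;> rw [h2] <;> push_cast <;> ring
  refine ⟨t.natAbs.minFac, Nat.minFac_prime hnat, ?_, a * M * s, ?_⟩
  · by_contra hle
    have hp := Nat.minFac_prime hnat
    have h1 : t.natAbs.minFac ∣ N.factorial := (Nat.Prime.dvd_factorial hp).2 (not_lt.1 hle)
    have h2 : (t.natAbs.minFac : ℤ) ∣ M := by rw [hM]; exact_mod_cast h1
    have h3 : (t.natAbs.minFac : ℤ) ∣ t := Int.natCast_dvd.2 (Nat.minFac_dvd _)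
    have h4 : (t.natAbs.minFac : ℤ) ∣ 1 := by
      have : (1 : ℤ) = t - M * (s * k) := by rw [ht]; ring
      rw [this]
      exact dvd_sub h3 (Dvd.dvd.mul_right h2 _)
    have h5 : t.natAbs.minFac ∣ 1 := by exact_mod_cast h4
    exact hp.one_lt.ne' (Nat.dvd_one.1 h5)
  · rw [← hev, hfe]
    exact Dvd.dvd.mul_left (Int.natCast_dvd.2 (Nat.minFac_dvd _)) _

theorem poly_padic_bound (p : ℚ[X]) : ∃ N : ℕ, ∀ (l : ℕ) [Fact l.Prime], N < l →
    ∀ z : ℚ_[l], ‖z‖ ≤ 1 → ‖aeval z p‖ ≤ 1 := by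
  induction p using Polynomial.induction_on' with
  | add p q hp hq =>
    obtain ⟨N1, h1⟩ := hp
    obtain ⟨N2, h2⟩ := hq
    refine ⟨max N1 N2, fun l _ hl z hz => ?_⟩
    rw [map_add]
    exact (Padic.nonarchimedean _ _).trans
      (max_le (h1 l (lt_of_le_of_lt (le_max_left _ _) hl) z hz)
        (h2 l (lt_of_le_of_lt (le_max_right _ _) hl) z hz))
  | monomial n q =>
    refine ⟨q.den, fun l _ hl z hz => ?_⟩
    rw [aeval_monomial, norm_mul, norm_pow]
    have : ‖algebraMap ℚ ℚ_[l] q‖ ≤ 1 := by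
      rw [eq_ratCast]
      apply Padic.norm_rat_le_one
      intro hd
      exact absurd (Nat.le_of_dvd q.den_pos hd) (not_le.2 hl)
    exact mul_le_one₀ this (by positivity) (pow_le_one₀ (norm_nonneg _) hz)

theorem numfield_padic {L : Type} [Field L] [Algebra ℚ L] [FiniteDimensional ℚ L]
    (S : Finset L) (N : ℕ) :
    ∃ (l : ℕ) (_ : Fact l.Prime), N < l ∧ ∃ φ : L →+* ℚ_[l], ∀ s ∈ S, ‖φ s‖ ≤ 1 := by
  classical
  set pb := Field.powerBasisOfFiniteOfSeparable ℚ L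
  set g := minpoly ℚ pb.gen with hg
  have hint : IsIntegral ℚ pb.gen := Algebra.IsIntegral.isIntegral _
  have hirr : Irreducible g := minpoly.irreducible hint
  obtain ⟨b, hb, hfb⟩ := IsLocalization.integerNormalization_spec (nonZeroDivisors ℤ) g
  set f := IsLocalization.integerNormalization (nonZeroDivisors ℤ) g
  have hb0 : b ≠ 0 := nonZeroDivisors.ne_zero hb
  have hfb' : f.map (algebraMap ℤ ℚ) = C (b : ℚ) * g := by
    rw [hfb, ← smul_eq_C_mul, Int.cast_smul_eq_zsmul]
  have hbu : IsUnit (C (b : ℚ)) := isUnit_C.2 (isUnit_iff_ne_zero.2 (by exact_mod_cast hb0))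
  have hirr' : Irreducible (f.map (algebraMap ℤ ℚ)) := by
    rw [hfb']
    exact (irreducible_isUnit_mul hbu).2 hirr
  have hdeg : 0 < f.natDegree := by
    rw [← natDegree_map_eq_of_injective (f := algebraMap ℤ ℚ)
      (by exact FaithfulSMul.algebraMap_injective ℤ ℚ)]
    exact hirr'.natDegree_pos
  obtain ⟨u, w, huw⟩ := hirr'.separable
  choose P hP using fun s : L => pb.exists_eq_aeval' s
  choose B hB using poly_padic_bound
  set N' := N + B u + B w + ∑ s ∈ S, B (P s) with hN'
  obtain ⟨l, hl, hlN, r, hr⟩ := schur_prime f hdeg N'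
  haveI : Fact l.Prime := ⟨hl⟩
  have ev : ∀ (q : ℤ[X]) (z : ℤ_[l]), ((aeval z q : ℤ_[l]) : ℚ_[l])
      = aeval (z : ℚ_[l]) (q.map (algebraMap ℤ ℚ)) := by
    intro q z
    rw [aeval_map_algebraMap]
    have := Polynomial.hom_eval₂ q (algebraMap ℤ ℤ_[l]) (PadicInt.Coe.ringHom (p := l)) z
    rw [aeval_def, aeval_def]
    refine this.trans ?_
    congr 1
  have hfr : ‖aeval (r : ℤ_[l]) f‖ < 1 := by
    have : aeval (r : ℤ_[l]) f = ((f.eval r : ℤ) : ℤ_[l]) := by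
      have := Polynomial.aeval_algebraMap_apply (A := ℤ) ℤ_[l] r f
      simpa using this
    rw [this, PadicInt.norm_int_lt_one_iff_dvd]
    exact hr
  have hr1 : ‖((r : ℤ_[l]) : ℚ_[l])‖ ≤ 1 := PadicInt.norm_le_one _
  have hfd : ‖aeval (r : ℤ_[l]) (derivative f)‖ = 1 := by
    refine le_antisymm (PadicInt.norm_le_one _) ?_
    by_contra hlt
    rw [not_le] at hlt
    have h1 := congrArg (aeval ((r : ℤ_[l]) : ℚ_[l])) huw
    rw [map_add, map_mul, map_mul, map_one, derivative_map, ← ev, ← ev] at h1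
    have hu := hB u l (by omega) _ hr1
    have hw := hB w l (by omega) _ hr1
    have h2 := Padic.nonarchimedean
      (aeval ((r : ℤ_[l]) : ℚ_[l]) u * ((aeval (r : ℤ_[l]) f : ℤ_[l]) : ℚ_[l]))
      (aeval ((r : ℤ_[l]) : ℚ_[l]) w * ((aeval (r : ℤ_[l]) (derivative f) : ℤ_[l]) : ℚ_[l]))
    rw [h1, norm_one, norm_mul, norm_mul, ← PadicInt.norm_def, ← PadicInt.norm_def] at h2
    rcases le_max_iff.1 h2 with h3 | h3
    · have := mul_le_mul_of_nonneg_right hu (norm_nonneg (aeval (r : ℤ_[l]) f))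
      linarith
    · have := mul_le_mul_of_nonneg_right hw (norm_nonneg (aeval (r : ℤ_[l]) (derivative f)))
      linarith
  obtain ⟨z, hz, -⟩ := hensels_lemma (F := f) (a := (r : ℤ_[l])) (by rw [hfd]; simpa using hfr)
  have hzg : aeval (z : ℚ_[l]) g = 0 := by
    have h1 := ev f z
    rw [hz, hfb', map_mul, aeval_C, eq_ratCast] at h1
    have h2 := (mul_eq_zero.1 h1.symm).resolve_left (by simpa using hb0)
    exact h2
  refine ⟨l, ⟨hl⟩, by omega, (pb.lift (z : ℚ_[l]) hzg).toRingHom, fun s hs => ?_⟩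
  have : (pb.lift (z : ℚ_[l]) hzg) s = aeval (z : ℚ_[l]) (P s) := by
    conv_lhs => rw [hP s]
    exact pb.lift_aeval _ _ _
  change ‖(pb.lift (z : ℚ_[l]) hzg) s‖ ≤ 1
  rw [this]
  refine hB (P s) l ?_ _ (PadicInt.norm_le_one _)
  have := Finset.single_le_sum (f := fun s => B (P s)) (fun _ _ => Nat.zero_le _) hs
  omega

theorem fintype_padic {T : Type} [CommRing T] [Nontrivial T] [Algebra ℚ T]
    [Algebra.FiniteType ℚ T] (S : Finset T) (N : ℕ) :
    ∃ (l : ℕ) (_ : Fact l.Prime), N < l ∧ ∃ φ : T →+* ℚ_[l], ∀ s ∈ S, ‖φ s‖ ≤ 1 := by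
  classical
  obtain ⟨m, hm⟩ := Ideal.exists_maximal T
  letI : Field (T ⧸ m) := Ideal.Quotient.field m
  letI : Algebra ℚ (T ⧸ m) := Ideal.Quotient.algebra ℚ
  haveI : Algebra.FiniteType ℚ (T ⧸ m) :=
    Algebra.FiniteType.of_surjective (Ideal.Quotient.mkₐ ℚ m) (Ideal.Quotient.mkₐ_surjective ℚ m)
  haveI : Module.Finite ℚ (T ⧸ m) := finite_of_finite_type_of_isJacobsonRing ℚ (T ⧸ m)
  obtain ⟨l, hl, hN, φ, hφ⟩ := numfield_padic (S.image (Ideal.Quotient.mk m)) N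
  exact ⟨l, hl, hN, φ.comp (Ideal.Quotient.mk m),
    fun s hs => hφ _ (Finset.mem_image_of_mem _ hs)⟩

theorem hom_to_zmod_sq {K : Type} [Field K] [CharZero K] (S : Finset K) (N : ℕ) :
    ∃ (l : ℕ), l.Prime ∧ N < l ∧
      Nonempty (Algebra.adjoin ℤ (S : Set K) →+* ZMod (l ^ 2)) := by
  classical
  have hT : Algebra.FiniteType ℚ (Algebra.adjoin ℚ (S : Set K)) :=
    (Subalgebra.fg_iff_finiteType _).1 ⟨S, rfl⟩
  have hsub : ∀ s : S, (s : K) ∈ (Algebra.adjoin ℚ (S : Set K)) :=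
    fun s => Algebra.subset_adjoin s.2
  obtain ⟨l, hl, hN, φ, hφ⟩ := fintype_padic (T := Algebra.adjoin ℚ (S : Set K))
    (S.attach.image fun s : S => ⟨(s : K), hsub s⟩) N
  have hle : ∀ x ∈ Algebra.adjoin ℤ (S : Set K), x ∈ Algebra.adjoin ℚ (S : Set K) := by
    intro x hx
    induction hx using Algebra.adjoin_induction with
    | mem x hx => exact Algebra.subset_adjoin hx
    | algebraMap r => rw [eq_intCast]; exact intCast_mem _ r
    | add x y hx hy h1 h2 => exact add_mem h1 h2
    | mul x y hx hy h1 h2 => exact mul_mem h1 h2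
  refine ⟨l, hl.1, hN, ?_⟩
  let ι : Algebra.adjoin ℤ (S : Set K) →+* Algebra.adjoin ℚ (S : Set K) :=
    { toFun := fun x => ⟨x, hle x x.2⟩
      map_one' := rfl
      map_mul' := fun _ _ => rfl
      map_zero' := rfl
      map_add' := fun _ _ => rfl }
  let χ : Algebra.adjoin ℤ (S : Set K) →+* ℚ_[l] := φ.comp ι
  have hχ : ∀ x, χ x ∈ PadicInt.subring l := by
    rintro ⟨x, hx⟩
    induction hx using Algebra.adjoin_induction with
    | mem x hx =>
      refine hφ _ ?_
      rw [Finset.mem_image]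
      exact ⟨⟨x, hx⟩, Finset.mem_attach _ _, rfl⟩
    | algebraMap r =>
      have : χ (algebraMap ℤ _ r) ∈ PadicInt.subring l := by
        rw [eq_intCast, map_intCast]
        exact intCast_mem _ r
      exact this
    | add x y hx hy h1 h2 =>
      have := (PadicInt.subring l).add_mem h1 h2
      rw [← map_add] at this
      exact this
    | mul x y hx hy h1 h2 =>
      have := (PadicInt.subring l).mul_mem h1 h2
      rw [← map_mul] at this
      exact this
  exact ⟨(PadicInt.toZModPow 2).comp (χ.codRestrict (PadicInt.subring l) hχ)⟩

end Padic7
end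

noncomputable section
open Polynomial

section Main8

theorem weyl_lift_exists {R S : Type} [CommRing R] [CommRing S] (ι : R →+* S) (w : WW S)
    (h : ∀ i j, ∃ r, ι r = cf w i j) : ∃ v, weylMap ι v = w := by
  classical
  choose c hc using h
  obtain ⟨d, hd⟩ := cf_bound w
  have hr := weyl_repr w (Finset.range d ×ˢ Finset.range d) (by
    intro i j hij
    by_contra hne
    apply hij
    simpa using hd i j hne)
  refine ⟨∑ u ∈ Finset.range d ×ˢ Finset.range d, c u.1 u.2 • (wx R ^ u.1 * wy R ^ u.2), ?_⟩
  conv_rhs => rw [hr]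
  rw [map_sum]
  refine Finset.sum_congr rfl fun u _ => ?_
  rw [weylMap_smul, hc, map_mul, map_pow, map_pow, weylMap_x, weylMap_y]

theorem zmod_sq_cast (l : ℕ) [hl : Fact l.Prime] (r : ZMod (l ^ 2)) :
    ZMod.castHom (dvd_pow_self l two_ne_zero) (ZMod l) r = 0 ↔ l ∣ r.val := by
  haveI : NeZero (l ^ 2) := ⟨pow_ne_zero _ hl.out.ne_zero⟩
  conv_lhs => rw [← ZMod.natCast_zmod_val r]
  rw [map_natCast, ZMod.natCast_eq_zero_iff]

theorem zmod_sq_hk (l : ℕ) [hl : Fact l.Prime] (r : ZMod (l ^ 2))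
    (h : ZMod.castHom (dvd_pow_self l two_ne_zero) (ZMod l) r = 0) : ∃ t, r = l * t := by
  haveI : NeZero (l ^ 2) := ⟨pow_ne_zero _ hl.out.ne_zero⟩
  obtain ⟨t, ht⟩ := (zmod_sq_cast l r).1 h
  refine ⟨t, ?_⟩
  rw [← ZMod.natCast_zmod_val r, ht, Nat.cast_mul]

theorem zmod_sq_hk' (l : ℕ) [hl : Fact l.Prime] (r : ZMod (l ^ 2)) :
    ZMod.castHom (dvd_pow_self l two_ne_zero) (ZMod l) r = 0 ↔ (l : ZMod (l ^ 2)) * r = 0 := by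
  haveI : NeZero (l ^ 2) := ⟨pow_ne_zero _ hl.out.ne_zero⟩
  rw [zmod_sq_cast]
  conv_rhs => rw [← ZMod.natCast_zmod_val r, ← Nat.cast_mul, ZMod.natCast_eq_zero_iff]
  generalize r.val = v
  rw [pow_two]
  exact (Nat.mul_dvd_mul_iff_left hl.out.pos).symm

theorem main_char0 {K : Type} [Field K] [CharZero K] {A B : WW K} (hAB : B * A = A * B + 1)
    (hA : beta A = A) (hB : beta B = -B) (i0 j0 : ℕ) (hi : cf B i0 j0 ≠ 0) : i0 = 0 := by
  classical
  obtain ⟨d1, hd1⟩ := cf_bound A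
  obtain ⟨d2, hd2⟩ := cf_bound B
  set d := max d1 d2
  set s := Finset.range d ×ˢ Finset.range d
  have hAd : ∀ i j, cf A i j ≠ 0 → i < d ∧ j < d := fun i j h =>
    ⟨(hd1 i j h).1.trans_le (le_max_left _ _), (hd1 i j h).2.trans_le (le_max_left _ _)⟩
  have hBd : ∀ i j, cf B i j ≠ 0 → i < d ∧ j < d := fun i j h =>
    ⟨(hd2 i j h).1.trans_le (le_max_right _ _), (hd2 i j h).2.trans_le (le_max_right _ _)⟩
  set S : Finset K := (s.image fun u => cf A u.1 u.2) ∪ (s.image fun u => cf B u.1 u.2)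
    ∪ {(cf B i0 j0)⁻¹} with hS
  set R0 := Algebra.adjoin ℤ (S : Set K) with hR0
  obtain ⟨l, hl, hlN, ⟨χ⟩⟩ := hom_to_zmod_sq S (d * d + 2)
  haveI : Fact l.Prime := ⟨hl⟩
  let ι : R0 →+* K := R0.val.toRingHom
  have hι : Function.Injective ι := Subtype.val_injective
  have cA : ∀ i j, ∃ r, ι r = cf A i j := by
    intro i j
    by_cases h : cf A i j = 0
    · exact ⟨0, by rw [h, map_zero]⟩
    · refine ⟨⟨cf A i j, Algebra.subset_adjoin ?_⟩, rfl⟩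
      rw [hS, Finset.mem_coe, Finset.mem_union, Finset.mem_union]
      left; left
      refine Finset.mem_image.2 ⟨(i, j), ?_, rfl⟩
      simpa [s] using hAd i j h
  have cB : ∀ i j, ∃ r, ι r = cf B i j := by
    intro i j
    by_cases h : cf B i j = 0
    · exact ⟨0, by rw [h, map_zero]⟩
    · refine ⟨⟨cf B i j, Algebra.subset_adjoin ?_⟩, rfl⟩
      rw [hS, Finset.mem_coe, Finset.mem_union, Finset.mem_union]
      left; right
      refine Finset.mem_image.2 ⟨(i, j), ?_, rfl⟩
      simpa [s] using hBd i j h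
  obtain ⟨A0, hA0⟩ := weyl_lift_exists ι A cA
  obtain ⟨B0, hB0⟩ := weyl_lift_exists ι B cB
  have hinj := weylMap_inj ι hι
  have hAB0 : B0 * A0 = A0 * B0 + 1 := by
    apply hinj
    rw [map_mul, map_add, map_mul, map_one, hA0, hB0, hAB]
  have hbA0 : beta A0 = A0 := by
    apply hinj
    rw [weylMap_beta, hA0, hA]
  have hbB0 : beta B0 = -B0 := by
    apply hinj
    rw [weylMap_beta, map_neg, hB0, hB]
  let π := ZMod.castHom (dvd_pow_self l two_ne_zero) (ZMod l)
  have cf0 : ∀ (w : WW R0) i j, cf (weylMap ι w) i j = 0 →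
      cf (weylMap π (weylMap χ w)) i j = 0 := by
    intro w i j h
    rw [cf_weylMap] at h
    have : cf w i j = 0 := hι (by rw [h, map_zero])
    rw [cf_weylMap, cf_weylMap, this, map_zero, map_zero]
  refine modl_main π l (by omega) (zmod_sq_hk l) (zmod_sq_hk' l) ?_
    (A := weylMap χ A0) (B := weylMap χ B0) ?_ ?_ ?_ d (by omega) ?_ ?_ i0 j0 ?_
  · have := ZMod.natCast_self (l ^ 2)
    rwa [Nat.cast_pow] at this
  · rw [← map_mul, hAB0, map_add, map_mul, map_one]
  · rw [← weylMap_beta, hbA0]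
  · rw [← weylMap_beta, hbB0, map_neg]
  · intro i j h
    exact hAd i j fun h' => h (cf0 _ _ _ (by rw [hA0, h']))
  · intro i j h
    exact hBd i j fun h' => h (cf0 _ _ _ (by rw [hB0, h']))
  · have hmem : (cf B i0 j0)⁻¹ ∈ R0 := Algebra.subset_adjoin (by simp [hS])
    have h1 : cf B0 i0 j0 * ⟨_, hmem⟩ = 1 := by
      apply hι
      rw [map_mul, map_one, ← cf_weylMap, hB0]
      exact mul_inv_cancel₀ hi
    have h2 := congrArg (fun r => π (χ r)) h1
    simp only [map_mul, map_one] at h2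
    rw [cf_weylMap, cf_weylMap]
    intro h3
    rw [h3, zero_mul] at h2
    exact zero_ne_one h2

end Main8
end

noncomputable section
open Polynomial

section End9

variable {K : Type} [Field K] [CharZero K]

theorem cf_aeval_y (p : K[X]) (i j : ℕ) :
    cf (aeval (wy K) p) i j = if i = 0 then p.coeff j else 0 := by
  have h := sym_mon (R := K) 0 p
  rw [pow_zero, one_mul] at h
  rw [cf, h, coeff_monomial]
  by_cases hi : i = 0
  · subst hi; simp
  · rw [if_neg hi, if_neg (Ne.symm hi), coeff_zero]

theorem aeval_y_inj {p q : K[X]} (h : aeval (wy K) p = aeval (wy K) q) : p = q := by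
  ext j
  have := congrArg (fun w => cf w 0 j) h
  simpa [cf_aeval_y] using this

theorem cf_zero_of_commY {w : WW K} (h : wy K * w = w * wy K) (i j : ℕ) : cf w (i + 1) j = 0 := by
  have h1 := cf_comm_y w i j
  rw [h, sub_self, cf_zero] at h1
  rcases mul_eq_zero.1 h1.symm with h2 | h2
  · exact absurd h2 (by exact_mod_cast Nat.succ_ne_zero i)
  · exact h2

theorem poly_of_cf {w : WW K} (h : ∀ i j, cf w (i + 1) j = 0) : ∃ p : K[X], w = aeval (wy K) p := by
  refine ⟨(sym K w).coeff 0, ?_⟩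
  apply cf_ext
  intro i j
  rw [cf_aeval_y]
  cases i with
  | zero => simp [cf]
  | succ i => rw [h]; simp

theorem poly_of_commY {w : WW K} (h : wy K * w = w * wy K) : ∃ p : K[X], w = aeval (wy K) p :=
  poly_of_cf (cf_zero_of_commY h)

theorem commY_poly (p : K[X]) : wy K * aeval (wy K) p = aeval (wy K) p * wy K := by
  conv_lhs => rw [← aeval_X (R := K) (wy K)]
  conv_rhs => rw [← aeval_X (R := K) (wy K)]
  simp only [aeval_X]
  have h1 : aeval (wy K) (X * p) = wy K * aeval (wy K) p := by rw [map_mul, aeval_X]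
  have h2 : aeval (wy K) (p * X) = aeval (wy K) p * wy K := by rw [map_mul, aeval_X]
  rw [← h1, ← h2, mul_comm]

theorem poly_comm (p q : K[X]) : aeval (wy K) p * aeval (wy K) q = aeval (wy K) q * aeval (wy K) p := by
  rw [← map_mul, ← map_mul, mul_comm]

/-- decomposition of an element whose commutator with `y` commutes with `y`. -/
theorem split_x {w : WW K} (h : wy K * (wy K * w - w * wy K) = (wy K * w - w * wy K) * wy K) :
    ∃ q q0 : K[X], wy K * w - w * wy K = aeval (wy K) q ∧
      w = wx K * aeval (wy K) q + aeval (wy K) q0 := by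
  obtain ⟨q, hq⟩ := poly_of_commY h
  have h0 : wy K * (w - wx K * aeval (wy K) q) = (w - wx K * aeval (wy K) q) * wy K := by
    have h1 := Wyx K
    have h2 : wy K * (wx K * aeval (wy K) q) = wx K * aeval (wy K) q * wy K + aeval (wy K) q := by
      rw [← mul_assoc, h1, add_mul, one_mul, mul_assoc, commY_poly, ← mul_assoc]
    rw [mul_sub, sub_mul, h2, ← hq]
    abel
  obtain ⟨q0, hq0⟩ := poly_of_commY h0
  exact ⟨q, q0, hq, by rw [← hq0]; abel⟩

theorem centralizer_poly (p : K[X])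
    (hp : aeval (wy K) p * wx K - wx K * aeval (wy K) p ≠ 0) (n : ℕ) :
    ∀ w : WW K, (∀ i j, n < i → cf w i j = 0) →
      aeval (wy K) p * w = w * aeval (wy K) p → wy K * w = w * wy K := by
  induction n with
  | zero =>
    intro w hw _
    obtain ⟨q, hq⟩ := poly_of_cf (fun i j => hw (i + 1) j (Nat.succ_pos i))
    rw [hq, commY_poly]
  | succ n ih =>
    intro w hw hc
    set B := aeval (wy K) p with hB
    have hBy : wy K * B = B * wy K := commY_poly p
    have h1 : wy K * (wy K * w - w * wy K) = (wy K * w - w * wy K) * wy K := by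
      apply ih
      · intro i j hij
        rw [cf_comm_y, hw (i + 1) j (by omega), mul_zero]
      · rw [mul_sub, sub_mul, ← mul_assoc, ← mul_assoc, ← hBy, hc, mul_assoc (wy K), hc]
        simp only [mul_assoc]
        rw [hBy]
    obtain ⟨q, q0, hq, hw'⟩ := split_x h1
    have h3 : (B * wx K - wx K * B) * aeval (wy K) q = 0 := by
      have hc1 := poly_comm p q
      have hc2 := poly_comm p q0
      rw [← hB] at hc1 hc2
      rw [hw', mul_add, add_mul, hc2] at hc
      have hc3 := add_right_cancel hc
      rw [sub_mul, mul_assoc, hc3, mul_assoc, mul_assoc, hc1, sub_self]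
    have h4 := (weyl_mul_eq_zero h3).resolve_left hp
    rw [h4] at hq
    exact sub_eq_zero.1 hq

theorem beta_poly (p : K[X]) (j : ℕ) : cf (beta (aeval (wy K) p)) 0 j = (-1) ^ j * p.coeff j := by
  have h : beta (aeval (wy K) p) = aeval (wy K) (p.comp (-X)) := by
    induction p using Polynomial.induction_on' with
    | add p q hp hq => rw [map_add, beta_add, hp, hq, add_comp, map_add]
    | monomial n a =>
      rw [← C_mul_X_pow_eq_monomial]
      simp only [map_mul, aeval_C, map_pow, aeval_X, mul_comp, C_comp, pow_comp, X_comp, map_neg]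
      rw [beta_mul, beta_pow, beta_y, beta_algebraMap, Algebra.commutes]
  rw [h, cf_aeval_y, if_pos rfl]
  have h2 : (-X : K[X]) = C (-1) * X := by simp
  rw [h2, comp_C_mul_X_coeff, mul_comm]

theorem end_char0 {A B : WW K} (hAB : B * A = A * B + 1)
    (hA : beta A = A) (hB : beta B = -B) :
    ∃ (c : K) (n : ℕ) (e : ℕ → K), c ≠ 0 ∧ B = c • wy K ∧
      A = c⁻¹ • wx K + ∑ j ∈ Finset.range (n + 1), e j • wy K ^ (2 * j) := by
  obtain ⟨p, hp⟩ := poly_of_cf (w := B) (fun i j => by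
    by_contra h
    exact absurd (main_char0 hAB hA hB _ _ h) (Nat.succ_ne_zero i))
  have hBy : wy K * B = B * wy K := by rw [hp]; exact commY_poly p
  have hcomm : B * A - A * B = 1 := by rw [hAB]; abel
  have hne : B * wx K - wx K * B ≠ 0 := by
    intro h
    have hall : ∀ w : WW K, B * w = w * B := by
      intro w
      induction w using weyl_induction with
      | hc r => exact (Algebra.commutes r B).symm
      | hx => exact sub_eq_zero.1 h
      | hy => exact hBy.symm
      | ha a b h1 h2 => rw [mul_add, add_mul, h1, h2]
      | hm a b h1 h2 => rw [← mul_assoc, h1, mul_assoc, h2, mul_assoc]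
    rw [hall A, sub_self] at hcomm
    exact zero_ne_one hcomm
  obtain ⟨d, hd⟩ := cf_bound (wy K * A - A * wy K)
  have hA' : wy K * (wy K * A - A * wy K) = (wy K * A - A * wy K) * wy K := by
    refine centralizer_poly p (by rw [← hp]; exact hne) d _ ?_ ?_
    · intro i j hij
      by_contra h
      exact absurd (hd i j h).1 (by omega)
    · rw [← hp]
      have e1 : B * (wy K * A) = wy K * (A * B) + wy K := by
        rw [← mul_assoc, ← hBy, mul_assoc, hAB, mul_add, mul_one]
      have e2 : B * (A * wy K) = A * wy K * B + wy K := by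
        rw [← mul_assoc, hAB, add_mul, one_mul, mul_assoc, mul_assoc, hBy]
      rw [mul_sub, sub_mul, e1, e2]
      rw [mul_assoc (wy K)]
      abel
  obtain ⟨q, q0, hq, hw⟩ := split_x hA'
  have hB'y : wy K * (B * wx K - wx K * B) = (B * wx K - wx K * B) * wy K := by
    have h1 := Wyx K
    have e1 : wy K * (B * wx K) = B * wx K * wy K + B := by
      rw [← mul_assoc, hBy, mul_assoc, h1, mul_add, mul_one, mul_assoc]
    have e2 : wy K * (wx K * B) = wx K * B * wy K + B := by
      rw [← mul_assoc, h1, add_mul, one_mul, mul_assoc, hBy, mul_assoc]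
    rw [mul_sub, sub_mul, e1, e2]
    abel
  obtain ⟨r, hr⟩ := poly_of_commY hB'y
  have hrq : r * q = 1 := by
    apply aeval_y_inj (K := K)
    rw [map_mul, map_one, ← hr, ← hcomm]
    conv_rhs => rw [hw]
    have hc1 := poly_comm p q
    have hc2 := poly_comm p q0
    rw [← hp] at hc1 hc2
    rw [mul_add, add_mul, hc2, sub_mul]
    rw [mul_assoc (wx K) (aeval (wy K) q), ← hc1]
    simp only [mul_assoc]
    abel
  obtain ⟨c, hcu, hc⟩ := Polynomial.isUnit_iff.1 (IsUnit.of_mul_eq_one q hrq)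
  have hc0 : c ≠ 0 := hcu.ne_zero
  have hqc : q = C c⁻¹ := by
    have : C c * q = C c * C c⁻¹ := by
      rw [hc, hrq, ← hc, ← C_mul, mul_inv_cancel₀ hc0, C_1]
    exact mul_left_cancel₀ (by simpa using hc0) this
  have hpc : ∀ j : ℕ, ((j : K) + 1) * p.coeff (j + 1) = (C c).coeff j := by
    intro j
    have := cf_comm_x B 0 j
    rw [hr, cf_aeval_y, if_pos rfl, hp, cf_aeval_y, if_pos rfl] at this
    rw [hc, this]
  have hp0 : p.coeff 0 = 0 := by
    have h1 := beta_poly p 0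
    have h2 : cf (-B) 0 0 = - p.coeff 0 := by
      rw [hp, ← zero_sub, cf_sub, cf_zero, cf_aeval_y, if_pos rfl, zero_sub]
    rw [← hp, hB, h2, pow_zero, one_mul] at h1
    exact self_eq_neg.1 h1.symm
  have hpX : p = C c * X := by
    ext j
    rcases j with _ | _ | j
    · simp [hp0]
    · have := hpc 0
      simpa using this
    · have := hpc (j + 1)
      rw [coeff_C_succ] at this
      have h2 := (mul_eq_zero.1 this).resolve_left (by exact_mod_cast Nat.succ_ne_zero (j + 1))
      rw [h2]
      simp
  have hq0 : ∀ j, (-1) ^ j * q0.coeff j = q0.coeff j := by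
    intro j
    have h1 : A - c⁻¹ • wx K = aeval (wy K) q0 := by
      conv_lhs => rw [hw]
      rw [hqc, aeval_C, ← Algebra.commutes, ← Algebra.smul_def]
      abel
    have h2 : beta (aeval (wy K) q0) = aeval (wy K) q0 := by
      rw [← h1, sub_eq_add_neg, beta_add, hA, beta_neg, beta_smul, beta_x]
    rw [← beta_poly, h2, cf_aeval_y, if_pos rfl]
  refine ⟨c, q0.natDegree, fun j => q0.coeff (2 * j), hc0, ?_, ?_⟩
  · rw [hp, hpX, map_mul, aeval_C, aeval_X, ← Algebra.smul_def]
  · conv_lhs => rw [hw]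
    rw [hqc, aeval_C, ← Algebra.commutes, ← Algebra.smul_def]
    congr 1
    rw [aeval_eq_sum_range' (n := 2 * (q0.natDegree + 1)) (by omega)]
    have hgen : ∀ m : ℕ, ∑ i ∈ Finset.range (2 * m), q0.coeff i • wy K ^ i =
        ∑ j ∈ Finset.range m, q0.coeff (2 * j) • wy K ^ (2 * j) := by
      intro m
      induction m with
      | zero => simp
      | succ m ih =>
        rw [Nat.mul_succ, Finset.sum_range_succ, Finset.sum_range_succ, ih, Finset.sum_range_succ]
        have : q0.coeff (2 * m + 1) = 0 := by
          have := hq0 (2 * m + 1)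
          rw [pow_succ, pow_mul] at this
          simp only [even_two, Even.neg_pow, one_pow, one_mul, neg_mul] at this
          exact self_eq_neg.1 this.symm
        rw [this, zero_smul, add_zero]
    exact hgen _

end End9
end

noncomputable section
open Polynomial

section End10

variable {K : Type} [Field K] [CharZero K]

theorem weyl_simple (P : WW K → Prop) (hy : ∀ w, P w → P (wy K * w - w * wy K))
    (hx : ∀ w, P w → P (w * wx K - wx K * w)) (n : ℕ) :
    ∀ w : WW K, P w → w ≠ 0 → (∀ i j, cf w i j ≠ 0 → i + j < n) →
      ∃ r : K, r ≠ 0 ∧ P (r • (1 : WW K)) := by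
  induction n with
  | zero =>
    intro w _ hw hd
    refine absurd (cf_ext fun i j => ?_) hw
    rw [cf_zero]
    by_contra h
    exact absurd (hd i j h) (by omega)
  | succ n ih =>
    intro w hP hw hd
    by_cases h1 : wy K * w - w * wy K = 0
    · by_cases h2 : w * wx K - wx K * w = 0
      · obtain ⟨p, hp⟩ := poly_of_commY (sub_eq_zero.1 h1)
        have hpC : p = C (p.coeff 0) := by
          ext j
          cases j with
          | zero => simp
          | succ j =>
            have := cf_comm_x w 0 j
            rw [h2, cf_zero, hp, cf_aeval_y, if_pos rfl] at this
            have h3 := (mul_eq_zero.1 this.symm).resolve_left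
              (by exact_mod_cast Nat.succ_ne_zero j)
            rw [h3, coeff_C_succ]
        have hw' : w = p.coeff 0 • (1 : WW K) := by
          rw [hp, hpC, aeval_C, Algebra.algebraMap_eq_smul_one, coeff_C_zero]
        refine ⟨p.coeff 0, fun h => hw ?_, hw' ▸ hP⟩
        rw [hw', h, zero_smul]
      · refine ih _ (hx w hP) h2 fun i j hij => ?_
        rw [cf_comm_x] at hij
        have := hd i (j + 1) (right_ne_zero_of_mul hij)
        omega
    · refine ih _ (hy w hP) h1 fun i j hij => ?_
      rw [cf_comm_y] at hij
      have := hd (i + 1) j (right_ne_zero_of_mul hij)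
      omega

theorem psi_rel : (wx K - wy K) * ((-(1/2) : K) • (wx K + wy K)) =
    ((-(1/2) : K) • (wx K + wy K)) * (wx K - wy K) + 1 := by
  have h : wy K * wx K = wx K * wy K + 1 := Wyx K
  rw [mul_smul_comm, smul_mul_assoc]
  have e : (wx K - wy K) * (wx K + wy K) =
      (wx K + wy K) * (wx K - wy K) + (-2 : K) • (1 : WW K) := by
    have h2 : (-2 : K) • (1 : WW K) = -1 - 1 := by
      rw [neg_smul, two_smul]; abel
    rw [h2]
    simp only [mul_add, add_mul, mul_sub, sub_mul, h]
    abel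
  rw [e, smul_add, smul_smul]
  norm_num

theorem phi_rel : (-wx K - (1/2 : K) • wy K) * (-wx K + (1/2 : K) • wy K) =
    (-wx K + (1/2 : K) • wy K) * (-wx K - (1/2 : K) • wy K) + 1 := by
  have h : wy K * wx K = wx K * wy K + 1 := Wyx K
  simp only [mul_add, add_mul, mul_sub, sub_mul, mul_neg, neg_mul, mul_smul_comm, smul_mul_assoc,
    smul_smul, h, smul_add]
  module

def psi (K : Type) [Field K] [CharZero K] : WW K →ₐ[K] WW K :=
  weylLift K ((-(1/2) : K) • (wx K + wy K)) (wx K - wy K) psi_rel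

def phi (K : Type) [Field K] [CharZero K] : WW K →ₐ[K] WW K :=
  weylLift K (-wx K + (1/2 : K) • wy K) (-wx K - (1/2 : K) • wy K) phi_rel

theorem psi_x : psi K (wx K) = (-(1/2) : K) • (wx K + wy K) := weylLift_x K _ _ _
theorem psi_y : psi K (wy K) = wx K - wy K := weylLift_y K _ _ _
theorem phi_x : phi K (wx K) = -wx K + (1/2 : K) • wy K := weylLift_x K _ _ _
theorem phi_y : phi K (wy K) = -wx K - (1/2 : K) • wy K := weylLift_y K _ _ _

theorem psi_phi (w : WW K) : psi K (phi K w) = w := by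
  have : (psi K).comp (phi K) = AlgHom.id K (WW K) := by
    apply weyl_hom_ext
    · simp only [AlgHom.comp_apply, phi_x, map_add, map_neg, map_smul, psi_x, psi_y, AlgHom.id_apply]
      module
    · simp only [AlgHom.comp_apply, phi_y, map_sub, map_neg, map_smul, psi_x, psi_y, AlgHom.id_apply]
      module
  exact DFunLike.congr_fun this w

theorem phi_psi (w : WW K) : phi K (psi K w) = w := by
  have : (phi K).comp (psi K) = AlgHom.id K (WW K) := by
    apply weyl_hom_ext
    · simp only [AlgHom.comp_apply, psi_x, map_add, map_neg, map_smul, phi_x, phi_y, AlgHom.id_apply]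
      module
    · simp only [AlgHom.comp_apply, psi_y, map_sub, map_neg, map_smul, phi_x, phi_y, AlgHom.id_apply]
      module
  exact DFunLike.congr_fun this w

theorem final_WW (α f : WW K → WW K)
    (αadd : ∀ a b, α (a + b) = α a + α b) (αsmul : ∀ (c : K) a, α (c • a) = c • α a)
    (αmul : ∀ a b, α (a * b) = α b * α a) (α1 : α 1 = 1)
    (αx : α (wx K) = wy K) (αy : α (wy K) = wx K)
    (fadd : ∀ a b, f (a + b) = f a + f b) (fsmul : ∀ (c : K) a, f (c • a) = c • f a)
    (fmul : ∀ a b, f (a * b) = f b * f a) (f1 : f 1 = 1)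
    (hcomm : ∀ w, f (α w) = α (f w)) :
    Function.Bijective f ∧ ∃ (n : ℕ) (a b : K) (c : ℕ → K), a ^ 2 - b ^ 2 = -1 ∧
      f (wx K) = a • wx K + b • wy K + ∑ j ∈ Finset.range (n + 1), c j • (wx K - wy K) ^ (2 * j) ∧
      f (wy K) = a • wy K + b • wx K + ∑ j ∈ Finset.range (n + 1), c j • (wx K - wy K) ^ (2 * j) := by
  classical
  have αsub : ∀ a b, α (a - b) = α a - α b := by
    intro a b
    have : a - b = a + (-1 : K) • b := by module
    rw [this, αadd, αsmul]; module
  have fsub : ∀ a b, f (a - b) = f a - f b := by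
    intro a b
    have : a - b = a + (-1 : K) • b := by module
    rw [this, fadd, fsmul]; module
  have f0 : f 0 = 0 := by
    have := fsub 0 0
    rwa [sub_self, sub_self] at this
  have fpow : ∀ (a : WW K) (n : ℕ), f (a ^ n) = f a ^ n := by
    intro a n
    induction n with
    | zero => rw [pow_zero, pow_zero, f1]
    | succ n ih => rw [pow_succ, fmul, ih, ← pow_succ']
  have fsum : ∀ (s : Finset ℕ) (g : ℕ → WW K), f (∑ j ∈ s, g j) = ∑ j ∈ s, f (g j) := by
    intro s g
    induction s using Finset.induction_on with
    | empty => simp [f0]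
    | insert a s ha ih => rw [Finset.sum_insert ha, Finset.sum_insert ha, fadd, ih]
  have αψ : ∀ w, α (psi K w) = psi K (beta w) := by
    intro w
    induction w using weyl_induction with
    | hc r => rw [beta_algebraMap, AlgHom.commutes, Algebra.algebraMap_eq_smul_one, αsmul, α1]
    | hx => rw [beta_x, psi_x, αsmul, αadd, αx, αy, add_comm]
    | hy => rw [beta_y, map_neg, psi_y, αsub, αx, αy, neg_sub]
    | ha a b h1 h2 => rw [map_add, αadd, h1, h2, beta_add, map_add]
    | hm a b h1 h2 => rw [map_mul, αmul, h1, h2, beta_mul, map_mul]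
  have ψinj : Function.Injective (psi K) := Function.LeftInverse.injective phi_psi
  set u := f (wx K) with hu
  set v := f (wy K) with hv
  have αu : α u = v := by rw [hu, ← hcomm, αx]
  have αv : α v = u := by rw [hv, ← hcomm, αy]
  have huv : u * v = v * u + 1 := by
    have := congrArg f (Wyx K)
    rwa [fmul, fadd, fmul, f1] at this
  set Af := (1/2 : K) • (u + v) with hAf
  set Bf := u - v with hBf
  have hABf : Bf * Af = Af * Bf + 1 := by
    rw [hAf, hBf, mul_smul_comm, smul_mul_assoc]
    have h1 : (1 : WW K) = (1/2 : K) • ((1 : WW K) + 1) := by module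
    have e : (u - v) * (u + v) = (u + v) * (u - v) + (1 + 1) := by
      simp only [mul_add, add_mul, mul_sub, sub_mul, huv]
      abel
    rw [e, smul_add, ← h1]
  have hAA : beta (phi K Af) = phi K Af := by
    apply ψinj
    rw [← αψ, psi_phi, hAf, αsmul, αadd, αu, αv, add_comm]
  have hBB : beta (phi K Bf) = - phi K Bf := by
    apply ψinj
    rw [← αψ, map_neg, psi_phi, hBf, αsub, αu, αv, neg_sub]
  obtain ⟨c, n, e, hc0, hB, hA⟩ := end_char0 (A := phi K Af) (B := phi K Bf)
    (by rw [← map_mul, hABf, map_add, map_mul, map_one]) hAA hBB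
  have hB' : u - v = c • (wx K - wy K) := by
    have := congrArg (psi K) hB
    rwa [psi_phi, map_smul, psi_y] at this
  set Q := ∑ j ∈ Finset.range (n + 1), e j • (wx K - wy K) ^ (2 * j) with hQ
  have hA' : (1/2 : K) • (u + v) = c⁻¹ • (-(1/2) : K) • (wx K + wy K) + Q := by
    have := congrArg (psi K) hA
    rw [psi_phi, map_add, map_smul, psi_x, map_sum] at this
    simp only [map_smul, map_pow, psi_y] at this
    exact this
  have hu' : u = ((c - c⁻¹) / 2) • wx K + (-(c + c⁻¹) / 2) • wy K + Q := by
    have : u = (1/2 : K) • (u + v) + (1/2 : K) • (u - v) := by module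
    rw [this, hA', hB']; module
  have hv' : v = ((c - c⁻¹) / 2) • wy K + (-(c + c⁻¹) / 2) • wx K + Q := by
    have : v = (1/2 : K) • (u + v) - (1/2 : K) • (u - v) := by module
    rw [this, hA', hB']; module
  refine ⟨⟨?_, ?_⟩, n, (c - c⁻¹) / 2, -(c + c⁻¹) / 2, e, ?_, hu', hv'⟩
  · intro a b hab
    by_contra hne
    obtain ⟨d, hd⟩ := cf_bound (a - b)
    obtain ⟨r, hr, hr0⟩ := weyl_simple (fun w => f w = 0)
      (fun w hw => by rw [fsub, fmul, fmul, hw]; simp)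
      (fun w hw => by rw [fsub, fmul, fmul, hw]; simp) (2 * d) (a - b)
      (by rw [fsub, hab, sub_self]) (sub_ne_zero.2 hne)
      (fun i j hij => by have := hd i j hij; omega)
    rw [fsmul, f1] at hr0
    rcases smul_eq_zero.1 hr0 with h | h
    · exact hr h
    · exact one_ne_zero h
  · have hD : f (c⁻¹ • (wx K - wy K)) = wx K - wy K := by
      rw [fsmul, fsub, ← hu, ← hv, hB', smul_smul, inv_mul_cancel₀ hc0, one_smul]
    have hQr : f (∑ j ∈ Finset.range (n + 1), e j • (c⁻¹ • (wx K - wy K)) ^ (2 * j)) = Q := by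
      rw [fsum, hQ]
      refine Finset.sum_congr rfl fun j _ => ?_
      rw [fsmul, fpow, hD]
    set q := ∑ j ∈ Finset.range (n + 1), e j • (c⁻¹ • (wx K - wy K)) ^ (2 * j)
    have hS : f ((-c) • ((wx K + wy K) - (2 : K) • q)) = wx K + wy K := by
      rw [fsmul, fsub, fadd, fsmul, hQr, ← hu, ← hv, hu', hv']
      match_scalars <;> field_simp <;> ring
    intro w
    induction w using weyl_induction with
    | hc r => exact ⟨r • 1, by rw [fsmul, f1, Algebra.algebraMap_eq_smul_one]⟩
    | hx =>
      refine ⟨(1/2 : K) • ((-c) • ((wx K + wy K) - (2 : K) • q) + c⁻¹ • (wx K - wy K)), ?_⟩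
      rw [fsmul, fadd, hS, hD]; module
    | hy =>
      refine ⟨(1/2 : K) • ((-c) • ((wx K + wy K) - (2 : K) • q) - c⁻¹ • (wx K - wy K)), ?_⟩
      rw [fsmul, fsub, hS, hD]; module
    | ha a b h1 h2 =>
      obtain ⟨a', rfl⟩ := h1
      obtain ⟨b', rfl⟩ := h2
      exact ⟨a' + b', fadd _ _⟩
    | hm a b h1 h2 =>
      obtain ⟨a', rfl⟩ := h1
      obtain ⟨b', rfl⟩ := h2
      exact ⟨b' * a', fmul _ _⟩
  · field_simp
    ring

end End10
end

/-- Every anti-endomorphism of `A₁` commuting with the exchange involution `α`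
is an anti-automorphism, and has the explicit form described. -/
theorem stmt_0 {K : Type} [Field K] [CharZero K]
    (α f : Weyl K → Weyl K) (hα : IsExchange K α)
    (hf : IsAntiEndo K f) (hcomm : f ∘ α = α ∘ f) :
    IsAntiAuto K f ∧
    ∃ (n : ℕ) (a b : K) (c : ℕ → K), a ^ 2 - b ^ 2 = -1 ∧
      f (Wx K) = a • Wx K + b • Wy K +
        ∑ j ∈ Finset.range (n + 1), c j • (Wx K - Wy K) ^ (2 * j) ∧
      f (Wy K) = a • Wy K + b • Wx K +
        ∑ j ∈ Finset.range (n + 1), c j • (Wx K - Wy K) ^ (2 * j) := by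
  obtain ⟨⟨⟨⟨a1, a2, a3, a4⟩, -⟩, -⟩, a5, a6⟩ := hα
  obtain ⟨f1, f2, f3, f4⟩ := hf
  have h := final_WW (K := K) α f a1 a2 a3 a4 a5 a6 f1 f2 f3 f4 (fun w => congrFun hcomm w)
  exact ⟨⟨⟨f1, f2, f3, f4⟩, h.1⟩, h.2⟩
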